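/- Consider the network with adaptive spatial diffusion coupling only, under aperiodically intermittent pinning control of node 1: let π, w¹, …, wᴺ : [−τ̄, ∞) × Ω̄ → ℝⁿ be continuous, vanish on [−τ̄, ∞) × ∂Ω, be continuously differentiable in t on (0,∞) with jointly continuous time derivative, and twice continuously differentiable in x with jointly continuous spatial derivatives, such that: π satisfies ∂π/∂t = f(π); for t in the control spans [t_i, s_i], ∂w¹/∂t = f(w¹) − Ψ(t)∑_k ξ_{1k}Γ²Δw^k − Ψ(t)σΓ²Δ(π − w¹), and for j = 2,…,N, ∂w^j/∂t = f(w^j) − Ψ(t)∑_k ξ_{jk}Γ²Δw^k; for t in the rest spans (s_i, t_{i+1}) and all j = 1,…,N, ∂w^j/∂t = f(w^j) − ∑_k ξ_{jk}Γ²Δw^k. Suppose Ψ(0) = 0, Ψ(t) = 0 on (s_i, t_{i+1}), Ψ(t_{i+1}) = Ψ(s_i), and on each [t_i, s_i], Ψ′(t) = ψ · max_{−τ̄ ≤ ς ≤ 0} ‖e(t+ς, ·)‖² with ψ > 0. If τ̄ < inf_i (s_i − t_i) and there exist 0 < θ < ω < ∞ with inf_i (s_i − t_i) = θ and sup_i (t_{i+1}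 − t_i) = ω, then lim_{t→∞} ‖e(t,·)‖ = 0. -/

import Mathlib

open MeasureTheory Set Matrix Filter

/-- The partial derivative `∂u/∂x_r` of a scalar field on `ℝ^m`. -/
noncomputable def par {m : ℕ} (u : EuclideanSpace ℝ (Fin m) → ℝ) (r : Fin m)
    (x : EuclideanSpace ℝ (Fin m)) : ℝ :=
  fderiv ℝ u x (EuclideanSpace.single r 1)

/-- The second partial derivative `∂²u/∂x_r²`. -/
noncomputable def par2 {m : ℕ} (u : EuclideanSpace ℝ (Fin m) → ℝ) (r : Fin m)
    (x : EuclideanSpace ℝ (Fin m)) : ℝ :=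
  par (par u r) r x

/-- The Laplacian `Δu = ∑_r ∂²u/∂x_r²`. -/
noncomputable def lap {m : ℕ} (u : EuclideanSpace ℝ (Fin m) → ℝ)
    (x : EuclideanSpace ℝ (Fin m)) : ℝ :=
  ∑ r, par2 u r x

/-- The `k`-th component of the uncoupled reaction-diffusion neural-network
drift `f(w)(t,x)`. -/
noncomputable def drift {m n : ℕ} (D : Fin n → Fin m → ℝ) (c : Fin n → ℝ)
    (A B : Matrix (Fin n) (Fin n) ℝ) (η : Fin n → ℝ)
    (g h : (Fin n → ℝ) → Fin n → ℝ) (τ : ℝ → ℝ)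
    (w : ℝ → EuclideanSpace ℝ (Fin m) → Fin n → ℝ)
    (t : ℝ) (x : EuclideanSpace ℝ (Fin m)) (k : Fin n) : ℝ :=
  (∑ r, D k r * par2 (fun y => w t y k) r x) - c k * w t x k
    + (∑ q, A k q * g (w t x) q) + (∑ q, B k q * h (w (t - τ t) x) q) + η k

/-- An irreducible matrix with nonnegative off-diagonal entries and zero row sums has a positive
left null vector. -/
theorem exists_pos_vecMul_eq_zero {ι : Type*} [Fintype ι] [DecidableEq ι] [Nonempty ι]
    (Ξ : Matrix ι ι ℝ) (hoff : ∀ j k, j ≠ k → 0 ≤ Ξ j k) (hrow : ∀ j, ∑ k, Ξ j k = 0)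
    (hirr : ∀ S : Finset ι, S.Nonempty → S ≠ Finset.univ → ∃ j ∈ S, ∃ k, k ∉ S ∧ 0 < Ξ j k) :
    ∃ p : ι → ℝ, (∀ j, 0 < p j) ∧ ∀ k, ∑ j, p j * Ξ j k = 0 := by
  have hdet : Ξ.det = 0 := by
    refine Matrix.exists_mulVec_eq_zero_iff.1 ⟨1, one_ne_zero, ?_⟩
    ext j
    simp [Matrix.mulVec, dotProduct, hrow]
  obtain ⟨v, hv0, hv⟩ := Matrix.exists_vecMul_eq_zero_iff.2 hdet
  have hvk : ∀ k, ∑ j, v j * Ξ j k = 0 := fun k => by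
    simpa [Matrix.vecMul, dotProduct] using congrFun hv k
  have hdiag : ∀ k, Ξ k k ≤ 0 := fun k => by
    have h1 := hrow k
    rw [← Finset.add_sum_erase _ _ (Finset.mem_univ k)] at h1
    have h2 : 0 ≤ ∑ j ∈ Finset.univ.erase k, Ξ k j :=
      Finset.sum_nonneg fun j hj => hoff k j (Finset.ne_of_mem_erase hj).symm
    linarith
  have hge : ∀ k, 0 ≤ ∑ j, |v j| * Ξ j k := fun k => by
    have h1 := hvk k
    rw [← Finset.add_sum_erase _ _ (Finset.mem_univ k)] at h1 ⊢
    have h2 : |v k * Ξ k k| ≤ ∑ j ∈ Finset.univ.erase k, |v j| * Ξ j k := by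
      rw [show v k * Ξ k k = -∑ j ∈ Finset.univ.erase k, v j * Ξ j k by linarith, abs_neg]
      refine (Finset.abs_sum_le_sum_abs _ _).trans (Finset.sum_le_sum fun j hj => ?_)
      rw [abs_mul, abs_of_nonneg (hoff j k (Finset.ne_of_mem_erase hj))]
    rw [abs_mul, abs_of_nonpos (hdiag k)] at h2
    linarith
  have hsum : ∑ k, ∑ j, |v j| * Ξ j k = 0 := by
    rw [Finset.sum_comm]
    simp [← Finset.mul_sum, hrow]
  have hzero : ∀ k, ∑ j, |v j| * Ξ j k = 0 := fun k =>
    (Finset.sum_eq_zero_iff_of_nonneg fun k _ => hge k).1 hsum k (Finset.mem_univ k)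
  refine ⟨fun j => |v j|, ?_, hzero⟩
  by_contra! hcon
  obtain ⟨i, hi⟩ := hcon
  obtain ⟨i', hi'⟩ := Function.ne_iff.1 hv0
  obtain ⟨j, hj, k, hk, hjk⟩ := hirr (Finset.univ.filter fun j => v j ≠ 0) ⟨i', by simpa using hi'⟩
    (fun h => by
      have : i ∈ Finset.univ.filter fun j => v j ≠ 0 := by
        rw [h]
        exact Finset.mem_univ i
      simp only [Finset.mem_filter, Finset.mem_univ, true_and] at this
      exact this (abs_nonpos_iff.1 hi))
  simp only [Finset.mem_filter, Finset.mem_univ, true_and, not_not] at hj hk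
  have h1 := hzero k
  have h2 := (Finset.sum_eq_zero_iff_of_nonneg (fun j _ => by
    rcases eq_or_ne j k with rfl | hne
    · simp [hk]
    · exact mul_nonneg (abs_nonneg _) (hoff _ _ hne))).1 h1 j (Finset.mem_univ j)
  have : 0 < |v j| * Ξ j k := mul_pos (abs_pos.2 hj) hjk
  linarith

/-- The quadratic form of a weighted coupling matrix as a sum of squares of differences. -/
theorem sum_sum_mul_eq_neg_sum_sq_sub {ι : Type*} [Fintype ι]
    (Ξ : Matrix ι ι ℝ) (hrow : ∀ j, ∑ k, Ξ j k = 0)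
    (p : ι → ℝ) (hp : ∀ k, ∑ j, p j * Ξ j k = 0) (y : ι → ℝ) :
    ∑ j, ∑ k, p j * Ξ j k * (y j * y k) = -(∑ j, ∑ k, p j * Ξ j k * (y j - y k) ^ 2) / 2 := by
  have h1 : ∑ j, ∑ k, p j * Ξ j k * y j ^ 2 = 0 := by
    refine Finset.sum_eq_zero fun j _ => ?_
    rw [← Finset.sum_mul, ← Finset.mul_sum, hrow]
    simp
  have h2 : ∑ j, ∑ k, p j * Ξ j k * y k ^ 2 = 0 := by
    rw [Finset.sum_comm]
    refine Finset.sum_eq_zero fun k _ => ?_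
    rw [← Finset.sum_mul, hp]
    simp
  have h3 : ∑ j, ∑ k, p j * Ξ j k * (y j - y k) ^ 2
      = ∑ j, ∑ k, p j * Ξ j k * y j ^ 2 + ∑ j, ∑ k, p j * Ξ j k * y k ^ 2
        - 2 * ∑ j, ∑ k, p j * Ξ j k * (y j * y k) := by
    simp only [Finset.mul_sum, ← Finset.sum_add_distrib, ← Finset.sum_sub_distrib]
    refine Finset.sum_congr rfl fun j _ => Finset.sum_congr rfl fun k _ => ?_
    ring
  rw [h3, h1, h2]
  ring

theorem sum_sum_mul_nonpos {ι : Type*} [Fintype ι]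
    (Ξ : Matrix ι ι ℝ) (hoff : ∀ j k, j ≠ k → 0 ≤ Ξ j k) (hrow : ∀ j, ∑ k, Ξ j k = 0)
    (p : ι → ℝ) (hpos : ∀ j, 0 < p j) (hp : ∀ k, ∑ j, p j * Ξ j k = 0) (y : ι → ℝ) :
    ∑ j, ∑ k, p j * Ξ j k * (y j * y k) ≤ 0 := by
  rw [sum_sum_mul_eq_neg_sum_sq_sub Ξ hrow p hp]
  have : 0 ≤ ∑ j, ∑ k, p j * Ξ j k * (y j - y k) ^ 2 :=
    Finset.sum_nonneg fun j _ => Finset.sum_nonneg fun k _ => by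
      rcases eq_or_ne j k with rfl | hne
      · simp
      · exact mul_nonneg (mul_nonneg (hpos j).le (hoff j k hne)) (sq_nonneg _)
  linarith

/-- Pinning one node makes the weighted coupling form negative definite. -/
theorem exists_pinned_form_le {ι : Type*} [Fintype ι] [DecidableEq ι]
    (Ξ : Matrix ι ι ℝ) (hoff : ∀ j k, j ≠ k → 0 ≤ Ξ j k) (hrow : ∀ j, ∑ k, Ξ j k = 0)
    (hirr : ∀ S : Finset ι, S.Nonempty → S ≠ Finset.univ → ∃ j ∈ S, ∃ k, k ∉ S ∧ 0 < Ξ j k)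
    (p : ι → ℝ) (hpos : ∀ j, 0 < p j) (hp : ∀ k, ∑ j, p j * Ξ j k = 0)
    (o : ι) {s : ℝ} (hs : 0 < s) :
    ∃ c > 0, ∀ y : ι → ℝ,
      ∑ j, ∑ k, p j * Ξ j k * (y j * y k) - s * y o ^ 2 ≤ -c * ∑ j, y j ^ 2 := by
  set F : EuclideanSpace ℝ ι → ℝ :=
    fun y => s * y o ^ 2 - ∑ j, ∑ k, p j * Ξ j k * (y j * y k) with hF
  have hFc : Continuous F := by fun_prop
  have hnn : ∀ (y : ι → ℝ) j k, 0 ≤ p j * Ξ j k * (y j - y k) ^ 2 := fun y j k => by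
    rcases eq_or_ne j k with rfl | hne
    · simp
    · exact mul_nonneg (mul_nonneg (hpos j).le (hoff j k hne)) (sq_nonneg _)
  have hFpos : ∀ y ∈ Metric.sphere (0 : EuclideanSpace ℝ ι) 1, 0 < F y := by
    intro y hy
    by_contra! hle
    have h0 := sum_sum_mul_nonpos Ξ hoff hrow p hpos hp y
    have ho : 0 ≤ s * y o ^ 2 := by positivity
    have hyo : y o = 0 := by
      have : s * y o ^ 2 = 0 := by simp only [hF] at hle; linarith
      simpa [hs.ne'] using this
    have hq : ∑ j, ∑ k, p j * Ξ j k * (y j - y k) ^ 2 = 0 := by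
      have := sum_sum_mul_eq_neg_sum_sq_sub Ξ hrow p hp y
      simp only [hF] at hle
      linarith [Finset.sum_nonneg fun j (_ : j ∈ Finset.univ) =>
        Finset.sum_nonneg fun k (_ : k ∈ Finset.univ) => hnn y j k]
    have hjk : ∀ j k, p j * Ξ j k * (y j - y k) ^ 2 = 0 := fun j k =>
      (Finset.sum_eq_zero_iff_of_nonneg fun k _ => hnn y j k).1
        ((Finset.sum_eq_zero_iff_of_nonneg fun j _ =>
          Finset.sum_nonneg fun k _ => hnn y j k).1 hq j (Finset.mem_univ j)) k (Finset.mem_univ k)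
    have hall : (Finset.univ.filter fun j => y j = 0) = Finset.univ := by
      by_contra hne
      obtain ⟨j, hj, k, hk, hpk⟩ := hirr _ ⟨o, by simpa using hyo⟩ hne
      simp only [Finset.mem_filter, Finset.mem_univ, true_and] at hj hk
      have := hjk j k
      simp [(hpos j).ne', hpk.ne', hj, hk] at this
    have hy0 : y = 0 := by
      ext j
      have : j ∈ Finset.univ.filter fun j => y j = 0 := by
        rw [hall]
        exact Finset.mem_univ j
      simpa using this
    simp [hy0] at hy
  obtain ⟨c, hc, hcF⟩ := (isCompact_sphere _ _).exists_forall_le' hFc.continuousOn hFpos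
  refine ⟨c, hc, fun y => ?_⟩
  set Y : EuclideanSpace ℝ ι := WithLp.toLp 2 y with hY
  have hn : ‖Y‖ ^ 2 = ∑ j, y j ^ 2 := by simp [EuclideanSpace.norm_sq_eq, hY]
  rcases eq_or_ne Y 0 with h0 | h0
  · have : y = 0 := by simpa [hY] using h0
    simp [this]
  · have hpos' : 0 < ‖Y‖ := norm_pos_iff.2 h0
    have h1 := hcF (‖Y‖⁻¹ • Y) (by simp [norm_smul, hpos'.ne'])
    have h2 : F (‖Y‖⁻¹ • Y) = (‖Y‖⁻¹) ^ 2 * F Y := by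
      simp only [hF, PiLp.smul_apply, smul_eq_mul, mul_sub, Finset.mul_sum]
      congr 1
      · ring
      · refine Finset.sum_congr rfl fun j _ => Finset.sum_congr rfl fun k _ => ?_
        ring
    rw [h2, inv_pow, inv_mul_eq_div, le_div_iff₀ (by positivity), hn] at h1
    simp only [hF, hY] at h1
    linarith

/-- A continuous function that starts positive and can only touch zero from below stays positive. -/
theorem pos_of_first_zero_deriv_pos {W W' : ℝ → ℝ} {a b : ℝ} (hW : ContinuousOn W (Icc a b))
    (ha : 0 < W a)
    (hd : ∀ t ∈ Ioc a b, W t = 0 → (∀ s ∈ Ico a t, 0 < W s) → HasDerivAt W (W' t) t ∧ 0 < W' t) :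
    ∀ t ∈ Icc a b, 0 < W t := by
  by_contra! hcon
  obtain ⟨t₁, ht₁, hWt₁⟩ := hcon
  have hcomp : IsCompact (Icc a b ∩ W ⁻¹' Iic 0) :=
    isCompact_Icc.of_isClosed_subset (hW.preimage_isClosed_of_isClosed isClosed_Icc isClosed_Iic)
      inter_subset_left
  obtain ⟨T, ⟨hTm, hTW⟩, hTmin⟩ := hcomp.exists_isLeast ⟨t₁, ht₁, hWt₁⟩
  have hbefore : ∀ s ∈ Ico a T, 0 < W s := fun s hs => by
    by_contra! h
    exact absurd (hTmin ⟨⟨hs.1, hs.2.le.trans hTm.2⟩, h⟩) (not_le.2 hs.2)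
  have haT : a < T := lt_of_le_of_ne hTm.1 fun h => by
    rw [← h] at hTW
    exact absurd hTW (not_le.2 ha)
  have hW0 : W T = 0 := by
    refine le_antisymm hTW ?_
    have hc : ContinuousWithinAt W (Iio T) T :=
      ((hW T hTm).mono (fun s hs => ⟨hs.1, hs.2.le.trans hTm.2⟩ :
        Ico a T ⊆ Icc a b)).mono_of_mem_nhdsWithin
        (Ico_mem_nhdsLT haT)
    refine ge_of_tendsto hc ?_
    filter_upwards [Ico_mem_nhdsLT haT] with s hs using (hbefore s hs).le
  obtain ⟨hder, hpos⟩ := hd T ⟨haT, hTm.2⟩ hW0 hbefore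
  have hslope := (hasDerivAt_iff_tendsto_slope_left_right.1 hder).1
  have hev := hslope.eventually (lt_mem_nhds hpos)
  obtain ⟨s, hs, hsT⟩ := (hev.and (Ico_mem_nhdsLT haT)).exists
  have h1 := hbefore s hsT
  rw [slope_def_field, hW0, sub_zero] at hs
  have : W s / (s - T) < 0 := div_neg_of_pos_of_neg h1 (sub_neg.2 hsT.2)
  linarith

/-- Exponential growth bound for a delay differential inequality. -/
theorem delay_growth {V V' τ : ℝ → ℝ} {τb β δ a C : ℝ} (hτ : ∀ t, τ t ∈ Icc 0 τb)
    (hβ : 0 ≤ β) (hδ : 0 ≤ δ) (ha : 0 ≤ a)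
    (hVc : ContinuousOn V (Ici (-τb))) (hVn : ∀ t ∈ Ici (-τb), 0 ≤ V t)
    (hVd : ∀ t > 0, HasDerivAt V (V' t) t)
    (hV' : ∀ t > 0, V' t ≤ β * V t + δ * V (t - τ t))
    (hw : ∀ s ∈ Icc (a - τb) a, V s < C) {t : ℝ} (hat : a ≤ t) :
    V t < C * Real.exp ((β + δ + 1) * (t - a)) := by
  have hτb : 0 ≤ τb := (hτ 0).1.trans (hτ 0).2
  have hC : 0 < C := (hVn a (by simp only [mem_Ici]; linarith)).trans_lt
    (hw a ⟨by linarith, le_rfl⟩)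
  set μ := β + δ + 1 with hμ
  have hμ0 : 0 < μ := by positivity
  have hB : ∀ s, HasDerivAt (fun s => C * Real.exp (μ * (s - a)))
      (μ * (C * Real.exp (μ * (s - a)))) s := by
    intro s
    have := ((((hasDerivAt_id s).sub_const a).const_mul μ).exp).const_mul C
    refine this.congr_deriv ?_
    simp only [id]; ring
  have key := pos_of_first_zero_deriv_pos (W := fun s => C * Real.exp (μ * (s - a)) - V s)
    (W' := fun s => μ * (C * Real.exp (μ * (s - a))) - V' s) (a := a) (b := t)
    ((continuous_iff_continuousAt.2 fun s => (hB s).continuousAt).continuousOn.sub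
      (hVc.mono fun s hs => by simp only [mem_Ici]; linarith [hs.1]))
    (by simpa using hw a ⟨by linarith, le_rfl⟩)
    (by
      intro T hT h0 hbef
      have hT0 : 0 < T := ha.trans_lt hT.1
      refine ⟨(hB T).sub (hVd T hT0), ?_⟩
      have hVT : V T = C * Real.exp (μ * (T - a)) := by linarith
      have hdel : V (T - τ T) ≤ C * Real.exp (μ * (T - a)) := by
        rcases lt_or_ge (T - τ T) a with hlt | hge
        · refine (hw _ ⟨by linarith [(hτ T).2, hT.1], hlt.le⟩).le.trans ?_
          exact le_mul_of_one_le_right hC.le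
            (Real.one_le_exp (mul_nonneg hμ0.le (by linarith [hT.1])))
        · rcases eq_or_lt_of_le (hτ T).1 with h | h
          · rw [← h, sub_zero, hVT]
          · have := hbef (T - τ T) ⟨hge, by linarith⟩
            have h2 : C * Real.exp (μ * (T - τ T - a)) ≤ C * Real.exp (μ * (T - a)) := by
              gcongr
              linarith
            linarith
      have h1 := hV' T hT0
      have h2 : δ * V (T - τ T) ≤ δ * (C * Real.exp (μ * (T - a))) := by gcongr
      have h3 : 0 < C * Real.exp (μ * (T - a)) := by positivity
      rw [hVT] at h1
      simp only [hμ] at *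
      nlinarith)
  linarith [key t ⟨hat, le_rfl⟩]

/-- Decay estimate for a delay differential inequality with strong damping. -/
theorem delay_decay {V V' τ : ℝ → ℝ} {τb K δ ρ a b C : ℝ} (hτ : ∀ t, τ t ∈ Icc 0 τb)
    (hδ : 0 ≤ δ) (hK : δ < K) (hρ : δ < K * ρ) (ha : 0 ≤ a)
    (hVc : ContinuousOn V (Ici (-τb))) (hVn : ∀ t ∈ Ici (-τb), 0 ≤ V t)
    (hVd : ∀ t > 0, HasDerivAt V (V' t) t)
    (hV' : ∀ t ∈ Ioc a b, V' t ≤ -K * V t + δ * V (t - τ t))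
    (hw : ∀ s ∈ Icc (a - τb) a, V s < C) {t : ℝ} (ht : t ∈ Icc a b) :
    V t < C * (Real.exp (-K * (t - a)) + ρ) := by
  have hτb : 0 ≤ τb := (hτ 0).1.trans (hτ 0).2
  have hC : 0 < C := (hVn a (by simp only [mem_Ici]; linarith)).trans_lt
    (hw a ⟨by linarith, le_rfl⟩)
  have hK0 : 0 < K := hδ.trans_lt hK
  have hρ0 : 0 < ρ := pos_of_mul_pos_right (hδ.trans_lt hρ) hK0.le
  have hVab : ContinuousOn V (Icc a b) :=
    hVc.mono fun s hs => by simp only [mem_Ici]; linarith [hs.1]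
  have key := pos_of_first_zero_deriv_pos (W := fun s => C - V s) (W' := fun s => - V' s)
    (a := a) (b := b) (continuousOn_const.sub hVab)
    (by simpa using hw a ⟨by linarith, le_rfl⟩)
    (by
      intro T hT h0 hbef
      have hT0 : 0 < T := ha.trans_lt hT.1
      refine ⟨(hVd T hT0).const_sub C, ?_⟩
      have hVT : V T = C := by linarith
      have hdel : V (T - τ T) ≤ C := by
        rcases lt_or_ge (T - τ T) a with hlt | hge
        · exact (hw _ ⟨by linarith [(hτ T).2, hT.1], hlt.le⟩).le
        · rcases eq_or_lt_of_le (hτ T).1 with h | h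
          · rw [← h, sub_zero, hVT]
          · linarith [hbef (T - τ T) ⟨hge, by linarith⟩]
      have h1 := hV' T hT
      have h2 : δ * V (T - τ T) ≤ δ * C := by gcongr
      rw [hVT] at h1
      nlinarith)
  have hlt : ∀ s ∈ Icc (a - τb) b, V s < C := fun s hs => by
    rcases le_total s a with h | h
    · exact hw s ⟨hs.1, h⟩
    · linarith [key s ⟨h, hs.2⟩]
  have hB : ∀ s, HasDerivAt (fun s => C * (Real.exp (-K * (s - a)) + ρ))
      (-K * (C * Real.exp (-K * (s - a)))) s := by
    intro s
    have := (((((hasDerivAt_id s).sub_const a).const_mul (-K)).exp).add_const ρ).const_mul C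
    refine this.congr_deriv ?_
    simp only [id]; ring
  have key2 := pos_of_first_zero_deriv_pos
    (W := fun s => C * (Real.exp (-K * (s - a)) + ρ) - V s)
    (W' := fun s => -K * (C * Real.exp (-K * (s - a))) - V' s) (a := a) (b := b)
    ((continuous_iff_continuousAt.2 fun s => (hB s).continuousAt).continuousOn.sub hVab)
    (by
      have := hw a ⟨by linarith, le_rfl⟩
      simp only [sub_self, mul_zero, Real.exp_zero]
      nlinarith)
    (by
      intro T hT h0 hbef
      have hT0 : 0 < T := ha.trans_lt hT.1
      refine ⟨(hB T).sub (hVd T hT0), ?_⟩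
      have hVT : V T = C * (Real.exp (-K * (T - a)) + ρ) := by linarith
      have hdel : δ * V (T - τ T) ≤ δ * C := by
        gcongr
        exact (hlt _ ⟨by linarith [(hτ T).2, hT.1], by linarith [(hτ T).1, hT.2]⟩).le
      have h1 := hV' T hT
      rw [hVT] at h1
      nlinarith)
  linarith [key2 t ht]

/-- Window bounds at a sequence of times with bounded gaps propagate to convergence. -/
theorem tendsto_zero_of_window_bounds {V V' τ : ℝ → ℝ} {τb β δ R : ℝ} (hτ : ∀ t, τ t ∈ Icc 0 τb)
    (hβ : 0 ≤ β) (hδ : 0 ≤ δ)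
    (hVc : ContinuousOn V (Ici (-τb))) (hVn : ∀ t ∈ Ici (-τb), 0 ≤ V t)
    (hVd : ∀ t > 0, HasDerivAt V (V' t) t)
    (hV' : ∀ t > 0, V' t ≤ β * V t + δ * V (t - τ t))
    {u C : ℕ → ℝ} (hu0 : ∀ i, 0 ≤ u i) (hgap : ∀ i, u (i + 1) - u i ≤ R)
    (hu : Tendsto u atTop atTop) (hC : Tendsto C atTop (nhds 0))
    (hw : ∀ i, ∀ s ∈ Icc (u i - τb) (u i), V s < C i) :
    Tendsto V atTop (nhds 0) := by
  have hτb : 0 ≤ τb := (hτ 0).1.trans (hτ 0).2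
  set μ := β + δ + 1 with hμ
  have hμ0 : 0 < μ := by positivity
  rw [Metric.tendsto_atTop]
  intro ε hε
  have hlim : Tendsto (fun i => C i * Real.exp (μ * R)) atTop (nhds 0) := by
    simpa using hC.mul_const (Real.exp (μ * R))
  obtain ⟨i₀, hi₀⟩ := eventually_atTop.1 (hlim.eventually (gt_mem_nhds hε))
  refine ⟨u i₀, fun t ht => ?_⟩
  have hex : ∃ n, t < u (i₀ + n) := by
    obtain ⟨i, hi⟩ := (hu.eventually (eventually_gt_atTop t)).exists_forall_of_atTop
    exact ⟨i, hi _ (by omega)⟩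
  classical
  obtain ⟨n, hn, hmin⟩ : ∃ n, t < u (i₀ + n) ∧ ∀ k < n, ¬ t < u (i₀ + k) :=
    ⟨Nat.find hex, Nat.find_spec hex, fun k hk => Nat.find_min hex hk⟩
  obtain ⟨k, rfl⟩ : ∃ k, n = k + 1 :=
    Nat.exists_eq_succ_of_ne_zero fun h => by subst h; exact absurd hn (not_lt.2 ht)
  have hk : u (i₀ + k) ≤ t := not_lt.1 (hmin k (Nat.lt_succ_self k))
  have h1 := delay_growth hτ hβ hδ (hu0 (i₀ + k)) hVc hVn hVd hV' (hw (i₀ + k)) hk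
  have hVt := hVn t (by simp only [mem_Ici]; linarith [hu0 i₀])
  have hCk : 0 < C (i₀ + k) := (hVn _ (by simp only [mem_Ici]; linarith [hu0 (i₀ + k)])).trans_lt
    (hw (i₀ + k) (u (i₀ + k)) ⟨by linarith, le_rfl⟩)
  have h2 : C (i₀ + k) * Real.exp (μ * (t - u (i₀ + k))) ≤ C (i₀ + k) * Real.exp (μ * R) := by
    have := hgap (i₀ + k)
    rw [add_assoc] at this
    gcongr
    linarith
  have h3 := hi₀ (i₀ + k) (by omega)
  rw [Real.dist_eq, sub_zero, abs_of_nonneg hVt]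
  linarith

/-- Convergence of a delayed energy under adaptive, aperiodically intermittent damping. -/
theorem tendsto_zero_of_adaptive_intermittent {V V' τ Ψ Φ : ℝ → ℝ} {τb β δ α κ θ ω : ℝ}
    {ts ss : ℕ → ℝ} (hτ : ∀ t, τ t ∈ Icc 0 τb)
    (hβ : 0 ≤ β) (hδ : 0 ≤ δ) (hα : 0 < α) (hκ : 0 < κ) (hθ : 0 < θ) (hτθ : τb < θ)
    (hVc : ContinuousOn V (Ici (-τb))) (hVn : ∀ t ∈ Ici (-τb), 0 ≤ V t)
    (hVd : ∀ t > 0, HasDerivAt V (V' t) t)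
    (hV' : ∀ t > 0, V' t ≤ β * V t + δ * V (t - τ t))
    (hts0 : ts 0 = 0) (hrs : ∀ i, ss i < ts (i + 1)) (htlim : Tendsto ts atTop atTop)
    (hwidth : ∀ i, θ ≤ ss i - ts i) (hperiod : ∀ i, ts (i + 1) - ts i ≤ ω)
    (hctrl : ∀ i, ∀ t ∈ Icc (ts i) (ss i), 0 < t →
      V' t ≤ β * V t - α * Ψ t * V t + δ * V (t - τ t))
    (hΨjump : ∀ i, Ψ (ts (i + 1)) = Ψ (ss i))
    (hΨd : ∀ i, ∀ t ∈ Icc (ts i) (ss i), HasDerivWithinAt Ψ (Φ t) (Icc (ts i) (ss i)) t)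
    (hΦ : ∀ t ≥ 0, ∀ s ∈ Icc (t - τb) t, κ * V s ≤ Φ t) :
    Tendsto V atTop (nhds 0) := by
  have hτb : 0 ≤ τb := (hτ 0).1.trans (hτ 0).2
  have hcs : ∀ i, ts i < ss i := fun i => by linarith [hwidth i]
  have htmono : StrictMono ts := strictMono_nat_of_lt_succ fun i => (hcs i).trans (hrs i)
  have ht0 : ∀ i, 0 ≤ ts i := fun i => hts0 ▸ htmono.monotone (Nat.zero_le i)
  have hΨc : ∀ i, ContinuousOn Ψ (Icc (ts i) (ss i)) := fun i t ht =>
    (hΨd i t ht).continuousWithinAt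
  have hΨi : ∀ i, ∀ t ∈ Ioo (ts i) (ss i), HasDerivAt Ψ (Φ t) t := fun i t ht =>
    (hΨd i t (Ioo_subset_Icc_self ht)).hasDerivAt (Icc_mem_nhds ht.1 ht.2)
  have hΦ0 : ∀ t ≥ 0, 0 ≤ Φ t := fun t ht =>
    (mul_nonneg hκ.le (hVn t (by simp only [mem_Ici]; linarith))).trans
      (hΦ t ht t ⟨by linarith, le_rfl⟩)
  have hΨm : ∀ i, MonotoneOn Ψ (Icc (ts i) (ss i)) := fun i =>
    monotoneOn_of_hasDerivWithinAt_nonneg (convex_Icc _ _) (hΨc i)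
      (fun t ht => by
        rw [interior_Icc] at ht
        exact (hΨi i t ht).hasDerivWithinAt)
      (fun t ht => by
        rw [interior_Icc] at ht
        exact hΦ0 t ((ht0 i).trans ht.1.le))
  have hamono : Monotone fun i => Ψ (ts i) := monotone_nat_of_le_succ fun i => by
    rw [hΨjump]
    exact hΨm i (left_mem_Icc.2 (hcs i).le) (right_mem_Icc.2 (hcs i).le) (hcs i).le
  set μ := β + δ + 1 with hμ
  have hμ0 : 0 < μ := by positivity
  rcases tendsto_atTop_of_monotone hamono with hinfty | ⟨L, hL⟩
  · -- The gain is unbounded: each period eventually halves the window bound.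
    have hω0 : 0 < ω := by linarith [hperiod 0, hrs 0, hcs 0]
    set ρ := Real.exp (-(μ * ω)) / 4 with hρ
    have hρ0 : 0 < ρ := by positivity
    have hKex : ∃ K, δ < K ∧ δ < K * ρ ∧ Real.exp (-K * (θ - τb)) < ρ := by
      have h1 : ∀ᶠ K : ℝ in atTop, δ < K := eventually_gt_atTop δ
      have h2 : ∀ᶠ K : ℝ in atTop, δ < K * ρ :=
        (tendsto_id.atTop_mul_const hρ0).eventually (eventually_gt_atTop δ)
      have h3 : ∀ᶠ K : ℝ in atTop, Real.exp (-K * (θ - τb)) < ρ := by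
        have : Tendsto (fun K : ℝ => Real.exp (-K * (θ - τb))) atTop (nhds 0) :=
          Real.tendsto_exp_atBot.comp
            (tendsto_neg_atTop_atBot.atBot_mul_const (sub_pos.2 hτθ))
        exact this.eventually (gt_mem_nhds hρ0)
      exact (h1.and (h2.and h3)).exists
    obtain ⟨K, hK1, hK2, hK3⟩ := hKex
    have hK0 : 0 < K := hδ.trans_lt hK1
    obtain ⟨i₀, hi₀⟩ := eventually_atTop.1
      (hinfty.eventually (eventually_ge_atTop ((K + β) / α)))
    have hstep : ∀ i ≥ i₀, ∀ C, (∀ s ∈ Icc (ts i - τb) (ts i), V s < C) →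
        ∀ s ∈ Icc (ts (i + 1) - τb) (ts (i + 1)), V s < C / 2 := by
      intro i hi C hw s hs
      have hC : 0 < C := (hVn (ts i) (by simp only [mem_Ici]; linarith [ht0 i])).trans_lt
        (hw (ts i) ⟨by linarith, le_rfl⟩)
      have hs0 : 0 ≤ ss i := (ht0 i).trans (hcs i).le
      have hgain : ∀ t ∈ Ioc (ts i) (ss i), V' t ≤ -K * V t + δ * V (t - τ t) := by
        intro t ht
        have htpos : 0 < t := (ht0 i).trans_lt ht.1
        have h1 := hctrl i t (Ioc_subset_Icc_self ht) htpos
        have h2 : (K + β) / α ≤ Ψ t := (hi₀ i hi).trans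
          (hΨm i (left_mem_Icc.2 (hcs i).le) (Ioc_subset_Icc_self ht) ht.1.le)
        rw [div_le_iff₀ hα] at h2
        have h3 := hVn t (by simp only [mem_Ici]; linarith)
        nlinarith
      have hend : ∀ s ∈ Icc (ss i - τb) (ss i), V s < C * (2 * ρ) := by
        intro s hs
        have hsm : s ∈ Icc (ts i) (ss i) := ⟨by linarith [hwidth i, hs.1], hs.2⟩
        refine (delay_decay hτ hδ hK1 hK2 (ht0 i) hVc hVn hVd hgain hw hsm).trans_le ?_
        have : Real.exp (-K * (s - ts i)) ≤ Real.exp (-K * (θ - τb)) := by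
          rw [Real.exp_le_exp]
          nlinarith [hwidth i, hs.1]
        gcongr
        linarith
      have hexp : 1 ≤ Real.exp (μ * ω) := Real.one_le_exp (by positivity)
      have hmul : C * (2 * ρ) * Real.exp (μ * ω) = C / 2 := by
        rw [hρ, Real.exp_neg]
        field_simp
        norm_num
      rcases le_total s (ss i) with h | h
      · have := hend s ⟨by linarith [hs.1, hrs i], h⟩
        have h2 : C * (2 * ρ) ≤ C * (2 * ρ) * Real.exp (μ * ω) :=
          le_mul_of_one_le_right (by positivity) hexp
        linarith
      · have h1 := delay_growth hτ hβ hδ hs0 hVc hVn hVd hV' hend h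
        have h2 : C * (2 * ρ) * Real.exp (μ * (s - ss i)) ≤ C * (2 * ρ) * Real.exp (μ * ω) := by
          gcongr
          linarith [hs.2, hperiod i, hcs i]
        linarith
    obtain ⟨C, hC⟩ : ∃ C, ∀ s ∈ Icc (ts i₀ - τb) (ts i₀), V s < C := by
      obtain ⟨M, hM⟩ := (isCompact_Icc (a := ts i₀ - τb) (b := ts i₀)).bddAbove_image
        (hVc.mono fun s hs => by simp only [mem_Ici]; linarith [hs.1, ht0 i₀])
      exact ⟨M + 1, fun s hs => (hM (mem_image_of_mem V hs)).trans_lt (by linarith)⟩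
    have hall : ∀ k, ∀ s ∈ Icc (ts (i₀ + k) - τb) (ts (i₀ + k)), V s < C * (1 / 2) ^ k := by
      intro k
      induction k with
      | zero => simpa using hC
      | succ k ih =>
        intro s hs
        have := hstep (i₀ + k) (by omega) _ ih s hs
        rw [pow_succ]
        linarith
    refine tendsto_zero_of_window_bounds (u := fun k => ts (i₀ + k)) (R := ω) hτ hβ hδ hVc hVn
      hVd hV' (fun k => ht0 _) (fun k => hperiod (i₀ + k))
      (htlim.comp (tendsto_add_atTop_nat i₀ |>.congr fun k => by ring)) ?_ hall
    simpa using (tendsto_pow_atTop_nhds_zero_of_lt_one (by norm_num : (0 : ℝ) ≤ 1 / 2)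
      (by norm_num)).const_mul C
  · -- The gain is bounded: its slope, hence the energy, is small once in each control span.
    have hmvt : ∀ i, ∃ u ∈ Ioo (ts i) (ss i), Φ u = (Ψ (ss i) - Ψ (ts i)) / (ss i - ts i) :=
      fun i => exists_hasDerivAt_eq_slope Ψ Φ (hcs i) (hΨc i) (hΨi i)
    choose u hu hΦu using hmvt
    have hL' : Tendsto (fun i => Ψ (ts (i + 1))) atTop (nhds L) :=
      hL.comp (tendsto_add_atTop_nat 1)
    have hdiff : Tendsto (fun i => (Ψ (ts (i + 1)) - Ψ (ts i)) / θ / κ + 1 / ((i : ℝ) + 1)) atTop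
        (nhds 0) := by
      simpa using (((hL'.sub hL).div_const θ).div_const κ).add
        tendsto_one_div_add_atTop_nhds_zero_nat
    refine tendsto_zero_of_window_bounds (R := 2 * ω) hτ hβ hδ hVc hVn hVd hV'
      (fun i => (ht0 i).trans (hu i).1.le) (fun i => ?_)
      (tendsto_atTop_mono (fun i => (hu i).1.le) htlim) hdiff (fun i s hs => ?_)
    · linarith [hperiod i, hperiod (i + 1), (hu i).1, (hu (i + 1)).2, hrs (i + 1)]
    · have h1 := hΦ (u i) ((ht0 i).trans (hu i).1.le) s hs
      have h2 : Φ (u i) ≤ (Ψ (ts (i + 1)) - Ψ (ts i)) / θ := by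
        rw [hΦu, ← hΨjump]
        have : Ψ (ts i) ≤ Ψ (ts (i + 1)) := hamono (Nat.le_succ i)
        exact div_le_div_of_nonneg_left (by linarith) hθ (hwidth i)
      have h3 : V s ≤ (Ψ (ts (i + 1)) - Ψ (ts i)) / θ / κ := by
        rw [le_div_iff₀ hκ]
        linarith
      have : 0 < 1 / ((i : ℝ) + 1) := by positivity
      linarith
section Box

variable {m : ℕ} {l : Fin (m + 1) → ℝ} {Ω : Set (EuclideanSpace ℝ (Fin (m + 1)))}

theorem box_eq_preimage (hΩ : Ω = {x : EuclideanSpace ℝ (Fin (m + 1)) | ∀ r, |x r| < l r}) :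
    Ω = WithLp.ofLp ⁻¹' (Set.pi univ fun r => Ioo (-l r) (l r)) := by
  ext x
  simp [hΩ, abs_lt]

theorem isOpen_box (hΩ : Ω = {x : EuclideanSpace ℝ (Fin (m + 1)) | ∀ r, |x r| < l r}) :
    IsOpen Ω := by
  rw [box_eq_preimage hΩ]
  exact (isOpen_set_pi finite_univ fun _ _ => isOpen_Ioo).preimage (PiLp.continuous_ofLp 2 _)

theorem closure_box (hl : ∀ r, 0 < l r)
    (hΩ : Ω = {x : EuclideanSpace ℝ (Fin (m + 1)) | ∀ r, |x r| < l r}) :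
    closure Ω = WithLp.ofLp ⁻¹' (Icc (-l) l) := by
  have h : closure (Set.pi univ fun r => Ioo (-l r) (l r)) = Icc (-l) l := by
    rw [closure_pi_set, ← Set.pi_univ_Icc]
    refine Set.pi_congr rfl fun r _ => closure_Ioo ?_
    linarith [hl r]
  rw [box_eq_preimage hΩ, ← h]
  exact ((PiLp.homeomorph 2 (fun _ : Fin (m + 1) => ℝ)).preimage_closure _).symm

theorem isCompact_closure_box (hl : ∀ r, 0 < l r)
    (hΩ : Ω = {x : EuclideanSpace ℝ (Fin (m + 1)) | ∀ r, |x r| < l r}) :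
    IsCompact (closure Ω) := by
  rw [closure_box hl hΩ]
  exact (PiLp.homeomorph 2 (fun _ : Fin (m + 1) => ℝ)).isCompact_preimage.2 isCompact_Icc

theorem mem_frontier_box
    (hΩ : Ω = {x : EuclideanSpace ℝ (Fin (m + 1)) | ∀ r, |x r| < l r})
    {x : EuclideanSpace ℝ (Fin (m + 1))} (hx : x ∈ closure Ω) {r : Fin (m + 1)}
    (hr : |x r| = l r) : x ∈ frontier Ω := by
  rw [(isOpen_box hΩ).frontier_eq]
  refine ⟨hx, fun h => ?_⟩
  rw [hΩ] at h
  exact (h r).ne hr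

theorem integrableOn_box (hl : ∀ r, 0 < l r)
    (hΩ : Ω = {x : EuclideanSpace ℝ (Fin (m + 1)) | ∀ r, |x r| < l r})
    {f : EuclideanSpace ℝ (Fin (m + 1)) → ℝ} (hf : ContinuousOn f (closure Ω)) :
    IntegrableOn f Ω :=
  (hf.integrableOn_compact (isCompact_closure_box hl hΩ)).mono_set subset_closure

/-- The integral over a box of a partial derivative of a function vanishing on the boundary
is zero. -/
theorem integral_box_par_eq_zero (hl : ∀ r, 0 < l r)
    (hΩ : Ω = {x : EuclideanSpace ℝ (Fin (m + 1)) | ∀ r, |x r| < l r})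
    {F G : EuclideanSpace ℝ (Fin (m + 1)) → ℝ} {r : Fin (m + 1)}
    (hF : ContinuousOn F (closure Ω)) (hF0 : ∀ x ∈ frontier Ω, F x = 0)
    (hFd : ∀ x ∈ Ω, DifferentiableAt ℝ F x) (hFG : ∀ x ∈ Ω, par F r x = G x)
    (hG : ContinuousOn G (closure Ω)) :
    ∫ x in Ω, G x = 0 := by
  set L : (Fin (m + 1) → ℝ) →L[ℝ] EuclideanSpace ℝ (Fin (m + 1)) :=
    (PiLp.continuousLinearEquiv 2 ℝ (fun _ : Fin (m + 1) => ℝ)).symm.toContinuousLinearMap with hL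
  have hLx : ∀ y, L y = WithLp.toLp 2 y := fun y => rfl
  set P : Set (Fin (m + 1) → ℝ) := Set.pi univ fun r => Ioo (-l r) (l r) with hP
  have hPΩ : ∀ y ∈ P, L y ∈ Ω := fun y hy => by
    rw [box_eq_preimage hΩ]
    exact hy
  have hIcc : ∀ y ∈ Icc (-l) l, L y ∈ closure Ω := fun y hy => by
    rw [closure_box hl hΩ]
    exact hy
  have hPIcc : P =ᵐ[volume] Icc (-l) l := Measure.univ_pi_Ioo_ae_eq_Icc
  have hPmeas : MeasurableSet P := MeasurableSet.univ_pi fun _ => measurableSet_Ioo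
  have hpull : ∫ x in Ω, G x = ∫ y in P, G (L y) := by
    have := (PiLp.volume_preserving_toLp (Fin (m + 1))).setIntegral_preimage_emb
      (MeasurableEquiv.toLp 2 (Fin (m + 1) → ℝ)).measurableEmbedding G Ω
    rw [← this]
    congr 2
    rw [box_eq_preimage hΩ]
    rfl
  set f : Fin (m + 1) → (Fin (m + 1) → ℝ) → ℝ := fun i y => if i = r then F (L y) else 0 with hf
  set f' : Fin (m + 1) → (Fin (m + 1) → ℝ) → (Fin (m + 1) → ℝ) →L[ℝ] ℝ :=
    fun i y => if i = r then (fderiv ℝ F (L y)).comp L else 0 with hf'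
  have hsum : ∀ y ∈ P, ∑ i, f' i y (Pi.single i 1) = G (L y) := fun y hy => by
    rw [Finset.sum_eq_single r (fun i _ hi => by simp [hf', hi]) (by simp)]
    simp only [hf', if_true, ContinuousLinearMap.comp_apply]
    exact hFG _ (hPΩ y hy)
  have hGL : ContinuousOn (fun y => G (L y)) (Icc (-l) l) :=
    hG.comp L.continuous.continuousOn hIcc
  have key := integral_divergence_of_hasFDerivAt_off_countable' (-l) l
    (fun r => by simpa using (hl r).le) f f' ∅ countable_empty
    (fun i => by
      by_cases hi : i = r
      · simp only [hf, hi, if_true]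
        exact hF.comp L.continuous.continuousOn hIcc
      · simp only [hf, hi, if_false]
        exact continuousOn_const)
    (fun y hy i => by
      by_cases hi : i = r
      · simp only [hf, hf', hi, if_true]
        exact (hFd _ (hPΩ y hy.1)).hasFDerivAt.comp y L.hasFDerivAt
      · simp only [hf, hf', hi, if_false]
        exact hasFDerivAt_const 0 y)
    (by
      rw [← integrableOn_congr_set_ae hPIcc, integrableOn_congr_fun hsum hPmeas,
        integrableOn_congr_set_ae hPIcc]
      exact hGL.integrableOn_compact isCompact_Icc)
  rw [← setIntegral_congr_set hPIcc, setIntegral_congr_fun hPmeas hsum] at key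
  rw [hpull, key]
  have hface : ∀ (i : Fin (m + 1)) (a : ℝ), |a| = l i →
      ∫ z in Icc ((-l) ∘ i.succAbove) (l ∘ i.succAbove), f i (i.insertNth a z) = 0 := by
    intro i a ha
    refine setIntegral_eq_zero_of_forall_eq_zero fun z hz => ?_
    by_cases hi : i = r
    · simp only [hf, hi, if_true]
      subst hi
      refine hF0 _ (mem_frontier_box hΩ (r := i) (hIcc _ ?_) (by simpa [hLx] using ha))
      rw [Fin.insertNth_mem_Icc]
      exact ⟨abs_le.1 ha.le, hz⟩
    · simp [hf, hi]
  refine Finset.sum_eq_zero fun i _ => ?_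
  rw [hface i (l i) (abs_of_pos (hl i)), hface i ((-l) i) (by simp [abs_of_pos (hl i)]), sub_zero]

/-- A scalar field `u` on the closed box with homogeneous Dirichlet data, together with continuous
extensions `u₁ r`, `u₂ r` of its first and second partial derivatives in the direction `r`. -/
structure DirichletField (Ω : Set (EuclideanSpace ℝ (Fin (m + 1))))
    (u : EuclideanSpace ℝ (Fin (m + 1)) → ℝ)
    (u₁ u₂ : Fin (m + 1) → EuclideanSpace ℝ (Fin (m + 1)) → ℝ) : Prop where
  cont : ContinuousOn u (closure Ω)
  cont₁ : ∀ r, ContinuousOn (u₁ r) (closure Ω)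
  cont₂ : ∀ r, ContinuousOn (u₂ r) (closure Ω)
  zero : ∀ x ∈ frontier Ω, u x = 0
  diff : ∀ x ∈ Ω, DifferentiableAt ℝ u x
  diff₁ : ∀ r, ∀ x ∈ Ω, DifferentiableAt ℝ (u₁ r) x
  par_eq : ∀ r, ∀ x ∈ Ω, par u r x = u₁ r x
  par_eq₁ : ∀ r, ∀ x ∈ Ω, par (u₁ r) r x = u₂ r x

namespace DirichletField

variable {u v : EuclideanSpace ℝ (Fin (m + 1)) → ℝ}
  {u₁ u₂ v₁ v₂ : Fin (m + 1) → EuclideanSpace ℝ (Fin (m + 1)) → ℝ}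

theorem sub (hu : DirichletField Ω u u₁ u₂) (hv : DirichletField Ω v v₁ v₂) :
    DirichletField Ω (fun x => u x - v x) (fun r x => u₁ r x - v₁ r x)
      (fun r x => u₂ r x - v₂ r x) where
  cont := hu.cont.sub hv.cont
  cont₁ r := (hu.cont₁ r).sub (hv.cont₁ r)
  cont₂ r := (hu.cont₂ r).sub (hv.cont₂ r)
  zero x hx := by rw [hu.zero x hx, hv.zero x hx, sub_zero]
  diff x hx := (hu.diff x hx).sub (hv.diff x hx)
  diff₁ r x hx := (hu.diff₁ r x hx).sub (hv.diff₁ r x hx)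
  par_eq r x hx := by
    rw [← hu.par_eq r x hx, ← hv.par_eq r x hx, par, fderiv_fun_sub (hu.diff x hx) (hv.diff x hx)]
    rfl
  par_eq₁ r x hx := by
    rw [← hu.par_eq₁ r x hx, ← hv.par_eq₁ r x hx, par,
      fderiv_fun_sub (hu.diff₁ r x hx) (hv.diff₁ r x hx)]
    rfl

theorem of_contDiffOn (ho : IsOpen Ω) (hu : ContDiffOn ℝ 2 u (closure Ω))
    (h0 : ∀ x ∈ frontier Ω, u x = 0) (h₁ : ∀ r, ContinuousOn (par u r) (closure Ω))
    (h₂ : ∀ r, ContinuousOn (par2 u r) (closure Ω)) :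
    DirichletField Ω u (par u) (par2 u) where
  cont := hu.continuousOn
  cont₁ := h₁
  cont₂ := h₂
  zero := h0
  diff x hx := ((hu.mono subset_closure).contDiffAt (ho.mem_nhds hx)).differentiableAt two_ne_zero
  diff₁ r x hx := by
    have h := (hu.mono subset_closure).contDiffAt (ho.mem_nhds hx)
    exact ((h.fderiv_right (m := 1) (by norm_num)).differentiableAt one_ne_zero).clm_apply
      (differentiableAt_const _)
  par_eq _ _ _ := rfl
  par_eq₁ _ _ _ := rfl

/-- Second partial derivatives of the underlying field in the interior. -/
theorem par2_eq (ho : IsOpen Ω) (hu : DirichletField Ω u u₁ u₂) (r : Fin (m + 1))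
    {x : EuclideanSpace ℝ (Fin (m + 1))} (hx : x ∈ Ω) : par2 u r x = u₂ r x := by
  rw [← hu.par_eq₁ r x hx, par2, par, par]
  congr 1
  refine Filter.EventuallyEq.fderiv_eq ?_
  filter_upwards [ho.mem_nhds hx] with y hy using hu.par_eq r y hy

/-- Integration by parts in one coordinate direction. -/
theorem integral_mul_second (hl : ∀ r, 0 < l r)
    (hΩ : Ω = {x : EuclideanSpace ℝ (Fin (m + 1)) | ∀ r, |x r| < l r})
    (hu : DirichletField Ω u u₁ u₂) (hv : DirichletField Ω v v₁ v₂) (r : Fin (m + 1)) :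
    ∫ x in Ω, u x * v₂ r x = -∫ x in Ω, u₁ r x * v₁ r x := by
  have hc₁ : ContinuousOn (fun x => u₁ r x * v₁ r x) (closure Ω) := (hu.cont₁ r).mul (hv.cont₁ r)
  have hc₂ : ContinuousOn (fun x => u x * v₂ r x) (closure Ω) := hu.cont.mul (hv.cont₂ r)
  have key := integral_box_par_eq_zero hl hΩ (r := r) (F := fun x => u x * v₁ r x)
    (G := fun x => u x * v₂ r x + u₁ r x * v₁ r x) (hu.cont.mul (hv.cont₁ r))
    (fun x hx => by rw [hu.zero x hx, zero_mul])
    (fun x hx => (hu.diff x hx).mul (hv.diff₁ r x hx))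
    (fun x hx => by
      rw [par, fderiv_fun_mul (hu.diff x hx) (hv.diff₁ r x hx), ← hv.par_eq₁ r x hx,
        ← hu.par_eq r x hx]
      simp only [par, _root_.add_apply, _root_.smul_apply, smul_eq_mul]
      ring)
    (hc₂.add hc₁)
  rw [integral_add (integrableOn_box hl hΩ hc₂) (integrableOn_box hl hΩ hc₁)] at key
  linarith

/-- Poincaré's inequality in one coordinate direction. -/
theorem integral_sq_le (hl : ∀ r, 0 < l r)
    (hΩ : Ω = {x : EuclideanSpace ℝ (Fin (m + 1)) | ∀ r, |x r| < l r})
    (hu : DirichletField Ω u u₁ u₂) (r : Fin (m + 1)) :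
    ∫ x in Ω, u x ^ 2 ≤ 4 * l r ^ 2 * ∫ x in Ω, u₁ r x ^ 2 := by
  have hx : ∀ x, DifferentiableAt ℝ (fun x : EuclideanSpace ℝ (Fin (m + 1)) => x r) x :=
    fun x => by fun_prop
  have hpx : ∀ x, fderiv ℝ (fun x : EuclideanSpace ℝ (Fin (m + 1)) => x r) x
      (EuclideanSpace.single r 1) = 1 := fun x => by
    have : HasFDerivAt (fun x : EuclideanSpace ℝ (Fin (m + 1)) => x r)
        (EuclideanSpace.proj r : EuclideanSpace ℝ (Fin (m + 1)) →L[ℝ] ℝ) x :=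
      (EuclideanSpace.proj r : EuclideanSpace ℝ (Fin (m + 1)) →L[ℝ] ℝ).hasFDerivAt
    rw [this.fderiv]
    simp
  have hcx : ContinuousOn (fun x : EuclideanSpace ℝ (Fin (m + 1)) => x r) (closure Ω) := by
    fun_prop
  have hcu : ContinuousOn (fun x => u x ^ 2) (closure Ω) := hu.cont.pow 2
  have hcu₁ : ContinuousOn (fun x => u₁ r x ^ 2) (closure Ω) := (hu.cont₁ r).pow 2
  have hcm : ContinuousOn (fun x => x r * (2 * (u x * u₁ r x))) (closure Ω) :=
    hcx.mul (continuousOn_const.mul (hu.cont.mul (hu.cont₁ r)))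
  have key := integral_box_par_eq_zero hl hΩ (r := r) (F := fun x => x r * (u x * u x))
    (G := fun x => u x ^ 2 + x r * (2 * (u x * u₁ r x)))
    (hcx.mul (hu.cont.mul hu.cont))
    (fun x hx => by rw [hu.zero x hx, zero_mul, mul_zero])
    (fun x h => (hx x).mul ((hu.diff x h).mul (hu.diff x h)))
    (fun x h => by
      rw [par, fderiv_fun_mul (hx x) ((hu.diff x h).fun_mul (hu.diff x h)),
        fderiv_fun_mul (hu.diff x h) (hu.diff x h), ← hu.par_eq r x h]
      simp only [par, _root_.add_apply, _root_.smul_apply, smul_eq_mul,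
        hpx]
      ring)
    (hcu.add hcm)
  rw [integral_add (integrableOn_box hl hΩ hcu) (integrableOn_box hl hΩ hcm)] at key
  have hle : ∫ x in Ω, -(x r * (2 * (u x * u₁ r x)))
      ≤ ∫ x in Ω, (1 / 2 * u x ^ 2 + 2 * l r ^ 2 * u₁ r x ^ 2) := by
    refine setIntegral_mono_on (integrableOn_box hl hΩ hcm.neg)
      (integrableOn_box hl hΩ ((continuousOn_const.mul hcu).add (continuousOn_const.mul hcu₁)))
      (isOpen_box hΩ).measurableSet fun x h => ?_
    have hxr : x r ^ 2 ≤ l r ^ 2 := by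
      rw [hΩ] at h
      exact sq_le_sq' (by linarith [(abs_lt.1 (h r)).1]) (abs_lt.1 (h r)).2.le
    have h2 : x r ^ 2 * u₁ r x ^ 2 ≤ l r ^ 2 * u₁ r x ^ 2 := by gcongr
    nlinarith [sq_nonneg (u x + 2 * (x r * u₁ r x))]
  rw [integral_neg, integral_add ((integrableOn_box hl hΩ hcu).const_mul _)
    ((integrableOn_box hl hΩ hcu₁).const_mul _), integral_const_mul,
    integral_const_mul] at hle
  linarith

end DirichletField

/-- Dissipation of a weighted energy by cross diffusion with a negative semidefinite coupling. -/
theorem integral_cross_diffusion_le (hl : ∀ r, 0 < l r)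
    (hΩ : Ω = {x : EuclideanSpace ℝ (Fin (m + 1)) | ∀ r, |x r| < l r})
    {ι κ : Type*} [Fintype ι] [Fintype κ]
    {u : ι → κ → EuclideanSpace ℝ (Fin (m + 1)) → ℝ}
    {u₁ u₂ : ι → κ → Fin (m + 1) → EuclideanSpace ℝ (Fin (m + 1)) → ℝ}
    (hu : ∀ j k, DirichletField Ω (u j k) (u₁ j k) (u₂ j k))
    {d : ι → κ → Fin (m + 1) → ℝ} (hd : ∀ j k r, 0 ≤ d j k r)
    {γ : κ → ℝ} {γ₀ : ℝ} (hγ₀ : 0 ≤ γ₀) (hγ : ∀ k, γ₀ ≤ γ k)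
    {Q : ι → ι → ℝ} {a : ℝ} (ha : 0 ≤ a)
    (hQ : ∀ y : ι → ℝ, ∑ j, ∑ i, Q j i * (y j * y i) ≤ -a * ∑ j, y j ^ 2) (r₀ : Fin (m + 1)) :
    ∫ x in Ω, ∑ j, ∑ k, ∑ r, (d j k r * (u j k x * u₂ j k r x)
        - ∑ i, γ k * Q j i * (u j k x * u₂ i k r x))
      ≤ -(a * γ₀ / (4 * l r₀ ^ 2)) * ∫ x in Ω, ∑ j, ∑ k, u j k x ^ 2 := by
  have hInt : ∀ {f : EuclideanSpace ℝ (Fin (m + 1)) → ℝ}, ContinuousOn f (closure Ω) →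
      Integrable f (volume.restrict Ω) := fun hf => integrableOn_box hl hΩ hf
  have hc : ∀ j k, ContinuousOn (u j k) (closure Ω) := fun j k => (hu j k).cont
  have hc₁ : ∀ j k r, ContinuousOn (u₁ j k r) (closure Ω) := fun j k => (hu j k).cont₁
  have hc₂ : ∀ j k r, ContinuousOn (u₂ j k r) (closure Ω) := fun j k => (hu j k).cont₂
  have hterm : ∀ j k r, ∫ x in Ω, (d j k r * (u j k x * u₂ j k r x)
        - ∑ i, γ k * Q j i * (u j k x * u₂ i k r x))
      = ∫ x in Ω, (∑ i, γ k * Q j i * (u₁ j k r x * u₁ i k r x)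
        - d j k r * (u₁ j k r x * u₁ j k r x)) := by
    intro j k r
    rw [integral_sub (hInt (by fun_prop)) (hInt (by fun_prop)),
      integral_sub (hInt (by fun_prop)) (hInt (by fun_prop)),
      integral_finsetSum _ (fun i _ => hInt (by fun_prop)),
      integral_finsetSum _ (fun i _ => hInt (by fun_prop))]
    simp only [integral_const_mul]
    rw [(hu j k).integral_mul_second hl hΩ (hu j k),
      Finset.sum_congr rfl fun i _ => by rw [(hu j k).integral_mul_second hl hΩ (hu i k)]]
    simp only [mul_neg, Finset.sum_neg_distrib]
    ring
  have hsum : ∫ x in Ω, ∑ j, ∑ k, ∑ r, (d j k r * (u j k x * u₂ j k r x)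
        - ∑ i, γ k * Q j i * (u j k x * u₂ i k r x))
      = ∫ x in Ω, ∑ j, ∑ k, ∑ r, (∑ i, γ k * Q j i * (u₁ j k r x * u₁ i k r x)
        - d j k r * (u₁ j k r x * u₁ j k r x)) := by
    rw [integral_finsetSum _ (fun j _ => hInt (by fun_prop)),
      integral_finsetSum _ (fun j _ => hInt (by fun_prop))]
    refine Finset.sum_congr rfl fun j _ => ?_
    rw [integral_finsetSum _ (fun k _ => hInt (by fun_prop)),
      integral_finsetSum _ (fun k _ => hInt (by fun_prop))]
    refine Finset.sum_congr rfl fun k _ => ?_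
    rw [integral_finsetSum _ (fun r _ => hInt (by fun_prop)),
      integral_finsetSum _ (fun r _ => hInt (by fun_prop))]
    exact Finset.sum_congr rfl fun r _ => hterm j k r
  have hpt : ∀ x, ∑ j, ∑ k, ∑ r, (∑ i, γ k * Q j i * (u₁ j k r x * u₁ i k r x)
        - d j k r * (u₁ j k r x * u₁ j k r x)) ≤ -(a * γ₀) * ∑ j, ∑ k, u₁ j k r₀ x ^ 2 := by
    intro x
    calc ∑ j, ∑ k, ∑ r, (∑ i, γ k * Q j i * (u₁ j k r x * u₁ i k r x)
          - d j k r * (u₁ j k r x * u₁ j k r x))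
        ≤ ∑ j, ∑ k, ∑ r, ∑ i, γ k * Q j i * (u₁ j k r x * u₁ i k r x) := by
          refine Finset.sum_le_sum fun j _ => Finset.sum_le_sum fun k _ =>
            Finset.sum_le_sum fun r _ => ?_
          linarith [mul_nonneg (hd j k r) (mul_self_nonneg (u₁ j k r x))]
      _ = ∑ k, ∑ r, γ k * ∑ j, ∑ i, Q j i * (u₁ j k r x * u₁ i k r x) := by
          rw [Finset.sum_comm]
          refine Finset.sum_congr rfl fun k _ => ?_
          rw [Finset.sum_comm]
          simp only [Finset.mul_sum, mul_assoc]
      _ ≤ ∑ k, ∑ r, γ k * (-a * ∑ j, u₁ j k r x ^ 2) := by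
          refine Finset.sum_le_sum fun k _ => Finset.sum_le_sum fun r _ => ?_
          exact mul_le_mul_of_nonneg_left (hQ fun j => u₁ j k r x) (hγ₀.trans (hγ k))
      _ ≤ ∑ k, -(a * γ₀) * ∑ j, u₁ j k r₀ x ^ 2 := by
          refine Finset.sum_le_sum fun k _ => ?_
          have hS : ∀ r, 0 ≤ ∑ j, u₁ j k r x ^ 2 := fun r =>
            Finset.sum_nonneg fun j _ => sq_nonneg _
          have h1 : ∀ r, γ k * (-a * ∑ j, u₁ j k r x ^ 2) ≤ -(a * γ₀) * ∑ j, u₁ j k r x ^ 2 :=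
            fun r => by
              have := mul_le_mul_of_nonneg_right (hγ k) (mul_nonneg ha (hS r))
              linarith
          refine (Finset.sum_le_sum fun r _ => h1 r).trans ?_
          rw [← Finset.mul_sum]
          exact mul_le_mul_of_nonpos_left
            (Finset.single_le_sum (fun r _ => hS r) (Finset.mem_univ r₀))
            (neg_nonpos.2 (mul_nonneg ha hγ₀))
      _ = -(a * γ₀) * ∑ j, ∑ k, u₁ j k r₀ x ^ 2 := by
          rw [← Finset.mul_sum, Finset.sum_comm]
  have hP : ∫ x in Ω, ∑ j, ∑ k, u j k x ^ 2
      ≤ 4 * l r₀ ^ 2 * ∫ x in Ω, ∑ j, ∑ k, u₁ j k r₀ x ^ 2 := by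
    rw [integral_finsetSum _ (fun j _ => hInt (by fun_prop)),
      integral_finsetSum _ (fun j _ => hInt (by fun_prop)), Finset.mul_sum]
    refine Finset.sum_le_sum fun j _ => ?_
    rw [integral_finsetSum _ (fun k _ => hInt (by fun_prop)),
      integral_finsetSum _ (fun k _ => hInt (by fun_prop)), Finset.mul_sum]
    exact Finset.sum_le_sum fun k _ => (hu j k).integral_sq_le hl hΩ r₀
  have hl0 : 0 < 4 * l r₀ ^ 2 := by have := hl r₀; positivity
  rw [hsum]
  calc _ ≤ ∫ x in Ω, -(a * γ₀) * ∑ j, ∑ k, u₁ j k r₀ x ^ 2 :=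
        integral_mono (hInt (by fun_prop)) (hInt (by fun_prop)) hpt
    _ = -(a * γ₀) * ∫ x in Ω, ∑ j, ∑ k, u₁ j k r₀ x ^ 2 := integral_const_mul _ _
    _ ≤ _ := by
        have h1 : (∫ x in Ω, ∑ j, ∑ k, u j k x ^ 2) / (4 * l r₀ ^ 2)
            ≤ ∫ x in Ω, ∑ j, ∑ k, u₁ j k r₀ x ^ 2 := by
          rw [div_le_iff₀ hl0]
          linarith
        have h2 := mul_le_mul_of_nonneg_left h1 (mul_nonneg ha hγ₀)
        have h3 : -(a * γ₀ / (4 * l r₀ ^ 2)) * ∫ x in Ω, ∑ j, ∑ k, u j k x ^ 2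
            = -(a * γ₀ * ((∫ x in Ω, ∑ j, ∑ k, u j k x ^ 2) / (4 * l r₀ ^ 2))) := by ring
        rw [h3]
        linarith

/-- Rate of change of the weighted energy of a pinned, diffusively coupled system of fields. -/
theorem energy_rate_le (hl : ∀ r, 0 < l r)
    (hΩ : Ω = {x : EuclideanSpace ℝ (Fin (m + 1)) | ∀ r, |x r| < l r})
    {ι κ : Type*} [Fintype ι] [DecidableEq ι] [Fintype κ]
    {u v ut R : ι → κ → EuclideanSpace ℝ (Fin (m + 1)) → ℝ}
    {u₁ u₂ : ι → κ → Fin (m + 1) → EuclideanSpace ℝ (Fin (m + 1)) → ℝ}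
    (hu : ∀ j k, DirichletField Ω (u j k) (u₁ j k) (u₂ j k))
    (hv : ∀ j k, ContinuousOn (v j k) (closure Ω))
    (hut : ∀ j k, ContinuousOn (ut j k) (closure Ω))
    {D : κ → Fin (m + 1) → ℝ} (hD : ∀ k r, 0 ≤ D k r)
    {γ : κ → ℝ} {γ₀ : ℝ} (hγ₀ : 0 ≤ γ₀) (hγ : ∀ k, γ₀ ≤ γ k)
    {p : ι → ℝ} (hp : ∀ j, 0 ≤ p j) (Ξ : Matrix ι ι ℝ) (o : ι) {q s a β δ : ℝ} (ha : 0 ≤ a)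
    (hQ : ∀ y : ι → ℝ,
      q * ∑ j, ∑ i, p j * Ξ j i * (y j * y i) - s * (p o * y o ^ 2) ≤ -a * ∑ j, y j ^ 2)
    (heq : ∀ x ∈ Ω, ∀ j k, ut j k x = ∑ r, D k r * u₂ j k r x + R j k x
      - q * (∑ i, Ξ j i * (γ k * ∑ r, u₂ i k r x))
      + (if j = o then s * (γ k * ∑ r, u₂ o k r x) else 0))
    (hR : ∀ x ∈ Ω, ∀ j,
      ∑ k, u j k x * R j k x ≤ β * ∑ k, u j k x ^ 2 + δ * ∑ k, v j k x ^ 2)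
    (r₀ : Fin (m + 1)) :
    ∑ j, p j * ∫ x in Ω, ∑ k, 2 * (u j k x * ut j k x)
      ≤ 2 * β * (∑ j, p j * ∫ x in Ω, ∑ k, u j k x ^ 2)
        + 2 * δ * (∑ j, p j * ∫ x in Ω, ∑ k, v j k x ^ 2)
        - a * γ₀ / (2 * l r₀ ^ 2) * ∑ j, ∫ x in Ω, ∑ k, u j k x ^ 2 := by
  have hInt : ∀ {f : EuclideanSpace ℝ (Fin (m + 1)) → ℝ}, ContinuousOn f (closure Ω) →
      Integrable f (volume.restrict Ω) := fun hf => integrableOn_box hl hΩ hf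
  have hc : ∀ j k, ContinuousOn (u j k) (closure Ω) := fun j k => (hu j k).cont
  have hc₂ : ∀ j k r, ContinuousOn (u₂ j k r) (closure Ω) := fun j k => (hu j k).cont₂
  set Q : ι → ι → ℝ := fun j i =>
    q * (p j * Ξ j i) - (if j = o then if i = o then s * p o else 0 else 0) with hQdef
  have hQ' : ∀ y : ι → ℝ, ∑ j, ∑ i, Q j i * (y j * y i) ≤ -a * ∑ j, y j ^ 2 := by
    intro y
    refine le_of_eq_of_le ?_ (hQ y)
    simp only [hQdef, sub_mul, Finset.sum_sub_distrib, ite_mul, zero_mul, Finset.mul_sum]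
    congr 1
    · refine Finset.sum_congr rfl fun j _ => Finset.sum_congr rfl fun i _ => ?_
      ring
    · rw [Finset.sum_eq_single o (fun j _ hj => by simp [hj]) (by simp)]
      simp
      ring
  have hdiff := integral_cross_diffusion_le hl hΩ hu (d := fun j k r => p j * D k r)
    (fun j k r => mul_nonneg (hp j) (hD k r)) hγ₀ hγ ha hQ' r₀
  set S : EuclideanSpace ℝ (Fin (m + 1)) → ℝ := fun x =>
    ∑ j, ∑ k, ∑ r, (p j * D k r * (u j k x * u₂ j k r x)
        - ∑ i, γ k * Q j i * (u j k x * u₂ i k r x)) with hS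
  have hSc : ContinuousOn S (closure Ω) := by fun_prop
  have hpt : ∀ x ∈ Ω, ∑ j, p j * ∑ k, 2 * (u j k x * ut j k x)
      ≤ 2 * S x + (2 * β * (∑ j, p j * ∑ k, u j k x ^ 2)
        + 2 * δ * (∑ j, p j * ∑ k, v j k x ^ 2)) := by
    intro x hx
    have hsplit : ∑ j, p j * ∑ k, 2 * (u j k x * ut j k x)
        = 2 * S x + 2 * ∑ j, p j * ∑ k, u j k x * R j k x := by
      simp only [hS, Finset.mul_sum, ← Finset.sum_add_distrib]
      refine Finset.sum_congr rfl fun j _ => Finset.sum_congr rfl fun k _ => ?_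
      rw [heq x hx j k]
      have hQsum : ∑ r, ∑ i, γ k * Q j i * (u j k x * u₂ i k r x)
          = p j * u j k x * (q * (∑ i, Ξ j i * (γ k * ∑ r, u₂ i k r x))
            - (if j = o then s * (γ k * ∑ r, u₂ o k r x) else 0)) := by
        rw [Finset.sum_comm]
        have : ∀ i, ∑ r, γ k * Q j i * (u j k x * u₂ i k r x)
            = p j * u j k x * (q * (Ξ j i * (γ k * ∑ r, u₂ i k r x)))
              - (if i = o then (if j = o then
                  s * p o * u j k x * (γ k * ∑ r, u₂ o k r x) else 0) else 0) := by
          intro i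
          rw [← Finset.mul_sum, ← Finset.mul_sum]
          simp only [hQdef]
          by_cases hi : i = o
          · by_cases hj : j = o
            · subst hi hj; simp; ring
            · simp [hi, hj]; ring
          · simp [hi]; ring
        rw [Finset.sum_congr rfl fun i _ => this i, Finset.sum_sub_distrib, ← Finset.mul_sum,
          ← Finset.mul_sum]
        by_cases hj : j = o
        · simp [hj]; ring
        · simp [hj]
      have hDsum : ∑ r, p j * D k r * (u j k x * u₂ j k r x)
          = p j * u j k x * ∑ r, D k r * u₂ j k r x := by
        rw [Finset.mul_sum]
        refine Finset.sum_congr rfl fun r _ => ?_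
        ring
      rw [← Finset.mul_sum, Finset.sum_sub_distrib, hQsum, hDsum]
      ring
    have h1 : ∑ j, p j * ∑ k, u j k x * R j k x
        ≤ β * (∑ j, p j * ∑ k, u j k x ^ 2) + δ * ∑ j, p j * ∑ k, v j k x ^ 2 := by
      rw [Finset.mul_sum, Finset.mul_sum, ← Finset.sum_add_distrib]
      refine Finset.sum_le_sum fun j _ => ?_
      have := mul_le_mul_of_nonneg_left (hR x hx j) (hp j)
      linarith
    rw [hsplit]
    linarith
  have hlin : ∀ f : ι → EuclideanSpace ℝ (Fin (m + 1)) → ℝ,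
      (∀ j, ContinuousOn (f j) (closure Ω)) →
      ∫ x in Ω, ∑ j, p j * f j x = ∑ j, p j * ∫ x in Ω, f j x := by
    intro f hf
    rw [integral_finsetSum _ (fun j _ => hInt (by fun_prop))]
    simp only [integral_const_mul]
  have hmono := setIntegral_mono_on (hInt (by fun_prop)) (hInt (by fun_prop))
    (isOpen_box hΩ).measurableSet hpt
  rw [integral_add (hInt (by fun_prop)) (hInt (by fun_prop)),
    integral_add (hInt (by fun_prop)) (hInt (by fun_prop)), integral_const_mul,
    integral_const_mul, integral_const_mul,
    hlin (fun j x => ∑ k, 2 * (u j k x * ut j k x)) (fun j => by fun_prop),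
    hlin (fun j x => ∑ k, u j k x ^ 2) (fun j => by fun_prop),
    hlin (fun j x => ∑ k, v j k x ^ 2) (fun j => by fun_prop)] at hmono
  have hsq : ∫ x in Ω, ∑ j, ∑ k, u j k x ^ 2 = ∑ j, ∫ x in Ω, ∑ k, u j k x ^ 2 :=
    integral_finsetSum _ (fun j _ => hInt (by fun_prop))
  replace hdiff : ∫ x in Ω, S x ≤ _ := hdiff
  rw [hsq] at hdiff
  have h4 : a * γ₀ / (2 * l r₀ ^ 2) = 2 * (a * γ₀ / (4 * l r₀ ^ 2)) := by
    have := (hl r₀).ne'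
    field_simp
    norm_num
  rw [h4]
  linarith

/-- Continuity of an integral over the box depending on a parameter. -/
theorem continuousOn_integral_box (hl : ∀ r, 0 < l r)
    (hΩ : Ω = {x : EuclideanSpace ℝ (Fin (m + 1)) | ∀ r, |x r| < l r})
    {φ : ℝ → EuclideanSpace ℝ (Fin (m + 1)) → ℝ} {a : ℝ}
    (hφ : ContinuousOn (fun z : ℝ × EuclideanSpace ℝ (Fin (m + 1)) => φ z.1 z.2)
      (Ici a ×ˢ closure Ω)) :
    ContinuousOn (fun t => ∫ x in Ω, φ t x) (Ici a) := by
  have hslice : ∀ t ∈ Ici a, ContinuousOn (φ t) (closure Ω) := fun t ht =>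
    hφ.comp (f := fun x => (t, x)) (by fun_prop) fun x hx => ⟨ht, hx⟩
  intro t ht
  obtain ⟨M, hM⟩ := ((isCompact_Icc (a := a) (b := t + 1)).prod
    (isCompact_closure_box hl hΩ)).exists_bound_of_continuousOn
    (hφ.mono (prod_mono_left Icc_subset_Ici_self))
  have hev : ∀ᶠ s in nhdsWithin t (Ici a), s ∈ Icc a (t + 1) := by
    filter_upwards [self_mem_nhdsWithin, mem_nhdsWithin_of_mem_nhds (Iio_mem_nhds (lt_add_one t))]
      with s hs hs' using ⟨hs, le_of_lt hs'⟩
  refine continuousWithinAt_of_dominated (bound := fun _ => M) ?_ ?_ ?_ ?_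
  · filter_upwards [hev] with s hs
    exact (integrableOn_box hl hΩ (hslice s hs.1)).aestronglyMeasurable
  · filter_upwards [hev] with s hs
    filter_upwards [ae_restrict_mem (isOpen_box hΩ).measurableSet] with x hx
    exact hM (s, x) ⟨hs, subset_closure hx⟩
  · exact integrableOn_box hl hΩ continuousOn_const
  · filter_upwards [ae_restrict_mem (isOpen_box hΩ).measurableSet] with x hx
    exact (hφ.comp (f := fun s => (s, x)) (by fun_prop)
      (fun s hs => ⟨hs, subset_closure hx⟩)) t ht

/-- Differentiation under an integral over the box. -/
theorem hasDerivAt_integral_box (hl : ∀ r, 0 < l r)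
    (hΩ : Ω = {x : EuclideanSpace ℝ (Fin (m + 1)) | ∀ r, |x r| < l r})
    {φ φ' : ℝ → EuclideanSpace ℝ (Fin (m + 1)) → ℝ}
    (hφ' : ContinuousOn (fun z : ℝ × EuclideanSpace ℝ (Fin (m + 1)) => φ' z.1 z.2)
      (Ioi 0 ×ˢ closure Ω))
    (hφ : ∀ t ∈ Ioi (0 : ℝ), ContinuousOn (φ t) (closure Ω))
    (hd : ∀ t ∈ Ioi (0 : ℝ), ∀ x ∈ closure Ω, HasDerivAt (fun s => φ s x) (φ' t x) t)
    {t : ℝ} (ht : 0 < t) :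
    HasDerivAt (fun t => ∫ x in Ω, φ t x) (∫ x in Ω, φ' t x) t := by
  have hsub : Icc (t / 2) (t + 1) ⊆ Ioi (0 : ℝ) := fun s hs => by
    simp only [mem_Ioi]
    linarith [hs.1]
  obtain ⟨M, hM⟩ := ((isCompact_Icc (a := t / 2) (b := t + 1)).prod
    (isCompact_closure_box hl hΩ)).exists_bound_of_continuousOn
    (hφ'.mono (prod_mono_left hsub))
  have hnhds : Icc (t / 2) (t + 1) ∈ nhds t := Icc_mem_nhds (by linarith) (by linarith)
  refine (hasDerivAt_integral_of_dominated_loc_of_deriv_le (bound := fun _ => M) hnhds ?_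
    (integrableOn_box hl hΩ (hφ t ht)) ?_ ?_ (integrableOn_box hl hΩ continuousOn_const) ?_).2
  · filter_upwards [hnhds] with s hs
    exact (integrableOn_box hl hΩ (hφ s (hsub hs))).aestronglyMeasurable
  · exact (integrableOn_box hl hΩ (hφ'.comp (f := fun x => (t, x)) (by fun_prop)
      fun x hx => ⟨ht, hx⟩)).aestronglyMeasurable
  · filter_upwards [ae_restrict_mem (isOpen_box hΩ).measurableSet] with x hx s hs
    exact hM (s, x) ⟨hs, subset_closure hx⟩
  · filter_upwards [ae_restrict_mem (isOpen_box hΩ).measurableSet] with x hx s hs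
    exact hd s (hsub hs) x (subset_closure hx)

end Box

/-- A bilinear form bounded through the entrywise `ℓ¹` norm of its matrix. -/
theorem sum_mul_sum_le {κ : Type*} [Fintype κ] (A : Matrix κ κ ℝ) (x z : κ → ℝ) :
    ∑ k, x k * ∑ q, A k q * z q ≤ (∑ k, ∑ q, |A k q|) / 2 * (∑ k, x k ^ 2 + ∑ k, z k ^ 2) := by
  rw [div_mul_eq_mul_div, Finset.sum_mul, Finset.sum_div]
  refine Finset.sum_le_sum fun k _ => ?_
  rw [Finset.mul_sum, Finset.sum_mul, Finset.sum_div]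
  refine Finset.sum_le_sum fun q _ => ?_
  have h1 : x k ^ 2 ≤ ∑ k, x k ^ 2 :=
    Finset.single_le_sum (f := fun k => x k ^ 2) (fun k _ => sq_nonneg _) (Finset.mem_univ k)
  have h2 : z q ^ 2 ≤ ∑ k, z k ^ 2 :=
    Finset.single_le_sum (f := fun k => z k ^ 2) (fun k _ => sq_nonneg _) (Finset.mem_univ q)
  have h3 : x k * (A k q * z q) ≤ |A k q| * ((x k ^ 2 + z q ^ 2) / 2) := by
    have h4 : |x k * z q| ≤ (x k ^ 2 + z q ^ 2) / 2 := by
      rw [abs_le]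
      constructor <;> nlinarith [sq_nonneg (x k + z q), sq_nonneg (x k - z q)]
    calc x k * (A k q * z q) = A k q * (x k * z q) := by ring
      _ ≤ |A k q * (x k * z q)| := le_abs_self _
      _ = |A k q| * |x k * z q| := abs_mul _ _
      _ ≤ _ := by gcongr
  have h5 : |A k q| * ((x k ^ 2 + z q ^ 2) / 2)
      ≤ |A k q| * ((∑ k, x k ^ 2 + ∑ k, z k ^ 2) / 2) := by gcongr
  linarith

theorem sum_sq_le_of_sqrt_le {κ : Type*} [Fintype κ] {x z : κ → ℝ} {L : ℝ}
    (h : Real.sqrt (∑ k, x k ^ 2) ≤ L * Real.sqrt (∑ k, z k ^ 2)) :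
    ∑ k, x k ^ 2 ≤ L ^ 2 * ∑ k, z k ^ 2 := by
  have h1 := pow_le_pow_left₀ (Real.sqrt_nonneg _) h 2
  rwa [mul_pow, Real.sq_sqrt (Finset.sum_nonneg fun k _ => sq_nonneg _),
    Real.sq_sqrt (Finset.sum_nonneg fun k _ => sq_nonneg _)] at h1

/-- The reaction terms of the error dynamics are controlled by the present and delayed errors. -/
theorem reaction_le {κ : Type*} [Fintype κ] {c : κ → ℝ} (hc : ∀ k, 0 < c k)
    (A B : Matrix κ κ ℝ) {g h : (κ → ℝ) → κ → ℝ} {gs hs : ℝ}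
    (hg : ∀ u v, Real.sqrt (∑ k, (g u k - g v k) ^ 2) ≤ gs * Real.sqrt (∑ k, (u k - v k) ^ 2))
    (hh : ∀ u v, Real.sqrt (∑ k, (h u k - h v k) ^ 2) ≤ hs * Real.sqrt (∑ k, (u k - v k) ^ 2))
    (u v u' v' : κ → ℝ) :
    ∑ k, (u k - v k) * (-(c k * (u k - v k)) + ∑ q, A k q * (g u q - g v q)
        + ∑ q, B k q * (h u' q - h v' q))
      ≤ ((∑ k, ∑ q, |A k q|) / 2 * (1 + gs ^ 2) + (∑ k, ∑ q, |B k q|) / 2)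
          * ∑ k, (u k - v k) ^ 2
        + (∑ k, ∑ q, |B k q|) / 2 * hs ^ 2 * ∑ k, (u' k - v' k) ^ 2 := by
  have hA0 : 0 ≤ (∑ k, ∑ q, |A k q|) / 2 :=
    div_nonneg (Finset.sum_nonneg fun k _ => Finset.sum_nonneg fun q _ => abs_nonneg _) two_pos.le
  have hB0 : 0 ≤ (∑ k, ∑ q, |B k q|) / 2 :=
    div_nonneg (Finset.sum_nonneg fun k _ => Finset.sum_nonneg fun q _ => abs_nonneg _) two_pos.le
  have h1 := sum_mul_sum_le A (fun k => u k - v k) (fun q => g u q - g v q)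
  have h2 := sum_mul_sum_le B (fun k => u k - v k) (fun q => h u' q - h v' q)
  have h3 := mul_le_mul_of_nonneg_left (sum_sq_le_of_sqrt_le (hg u v)) hA0
  have h4 := mul_le_mul_of_nonneg_left (sum_sq_le_of_sqrt_le (hh u' v')) hB0
  have h5 : ∑ k, (u k - v k) * -(c k * (u k - v k)) ≤ 0 :=
    Finset.sum_nonpos fun k _ => by nlinarith [hc k, mul_nonneg (hc k).le (sq_nonneg (u k - v k))]
  simp only [mul_add, Finset.sum_add_distrib] at *
  linarith

/-- Corollary 4: asymptotic complete synchronization of the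
reaction-diffusion neural network with adaptive spatial diffusion coupling
only, with time-varying delays, under aperiodically intermittent pinning
control of node `1` (index `0`), when the delay bound `τ̄` is smaller than the
infimum `θ` of the control span widths. -/
theorem adaptive_spatially_coupled_network_synchronization (m n N : ℕ)
    (l : Fin (m + 1) → ℝ) (hl : ∀ r, 0 < l r)
    (Ω : Set (EuclideanSpace ℝ (Fin (m + 1))))
    (hΩ : Ω = {x : EuclideanSpace ℝ (Fin (m + 1)) | ∀ r, |x r| < l r})
    (D : Fin (n + 1) → Fin (m + 1) → ℝ) (hD : ∀ k r, 0 ≤ D k r)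
    (c : Fin (n + 1) → ℝ) (hc : ∀ k, 0 < c k)
    (A B : Matrix (Fin (n + 1)) (Fin (n + 1)) ℝ) (η : Fin (n + 1) → ℝ)
    (τb : ℝ) (hτb : 0 < τb)
    (τ : ℝ → ℝ) (hτ : ∀ t, τ t ∈ Icc 0 τb)
    (g h : (Fin (n + 1) → ℝ) → Fin (n + 1) → ℝ)
    (gs hs : ℝ) (hgs : 0 < gs) (hhs : 0 < hs)
    (hLipg : ∀ u v, Real.sqrt (∑ k, (g u k - g v k) ^ 2) ≤
      gs * Real.sqrt (∑ k, (u k - v k) ^ 2))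
    (hLiph : ∀ u v, Real.sqrt (∑ k, (h u k - h v k) ^ 2) ≤
      hs * Real.sqrt (∑ k, (u k - v k) ^ 2))
    (Ξ : Matrix (Fin (N + 1)) (Fin (N + 1)) ℝ)
    (hΞoff : ∀ j k, j ≠ k → 0 ≤ Ξ j k)
    (hΞrow : ∀ j, ∑ k, Ξ j k = 0)
    (hΞirr : ∀ S : Finset (Fin (N + 1)), S.Nonempty → S ≠ Finset.univ →
      ∃ j ∈ S, ∃ k, k ∉ S ∧ 0 < Ξ j k)
    (σ : ℝ) (hσ : 0 < σ)
    (γ2 : Fin (n + 1) → ℝ) (hγ2 : ∀ k, 0 < γ2 k)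
    (ts ss : ℕ → ℝ) (hts0 : ts 0 = 0)
    (hcs : ∀ i, ts i < ss i) (hrs : ∀ i, ss i < ts (i + 1))
    (htlim : Tendsto ts atTop atTop)
    (θ ω : ℝ) (hθ : 0 < θ) (hθω : θ < ω)
    (hinf : (⨅ i, (ss i - ts i)) = θ) (hsup : (⨆ i, (ts (i + 1) - ts i)) = ω)
    (hτθ : τb < θ)
    (π : ℝ → EuclideanSpace ℝ (Fin (m + 1)) → Fin (n + 1) → ℝ)
    (w : Fin (N + 1) → ℝ → EuclideanSpace ℝ (Fin (m + 1)) → Fin (n + 1) → ℝ)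
    -- regularity of the target trajectory and of the node states
    (hπC : ContinuousOn (fun q : ℝ × EuclideanSpace ℝ (Fin (m + 1)) => π q.1 q.2)
      (Ici (-τb) ×ˢ closure Ω))
    (hwC : ∀ j, ContinuousOn
      (fun q : ℝ × EuclideanSpace ℝ (Fin (m + 1)) => w j q.1 q.2)
      (Ici (-τb) ×ˢ closure Ω))
    (hπbd : ∀ t ∈ Ici (-τb), ∀ x ∈ frontier Ω, π t x = 0)
    (hwbd : ∀ j, ∀ t ∈ Ici (-τb), ∀ x ∈ frontier Ω, w j t x = 0)
    (hπx : ∀ t ∈ Ici (-τb), ContDiffOn ℝ 2 (π t) (closure Ω))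
    (hwx : ∀ j, ∀ t ∈ Ici (-τb), ContDiffOn ℝ 2 (w j t) (closure Ω))
    (hπx1 : ∀ (k : Fin (n + 1)) (r : Fin (m + 1)), ContinuousOn
      (fun q : ℝ × EuclideanSpace ℝ (Fin (m + 1)) => par (fun y => π q.1 y k) r q.2)
      (Ici (-τb) ×ˢ closure Ω))
    (hπx2 : ∀ (k : Fin (n + 1)) (r : Fin (m + 1)), ContinuousOn
      (fun q : ℝ × EuclideanSpace ℝ (Fin (m + 1)) => par2 (fun y => π q.1 y k) r q.2)
      (Ici (-τb) ×ˢ closure Ω))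
    (hwx1 : ∀ j (k : Fin (n + 1)) (r : Fin (m + 1)), ContinuousOn
      (fun q : ℝ × EuclideanSpace ℝ (Fin (m + 1)) => par (fun y => w j q.1 y k) r q.2)
      (Ici (-τb) ×ˢ closure Ω))
    (hwx2 : ∀ j (k : Fin (n + 1)) (r : Fin (m + 1)), ContinuousOn
      (fun q : ℝ × EuclideanSpace ℝ (Fin (m + 1)) => par2 (fun y => w j q.1 y k) r q.2)
      (Ici (-τb) ×ˢ closure Ω))
    -- jointly continuous time derivatives on (0,∞)
    (hwt : ∀ j, ∃ w' : ℝ → EuclideanSpace ℝ (Fin (m + 1)) → Fin (n + 1) → ℝ,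
      ContinuousOn (fun q : ℝ × EuclideanSpace ℝ (Fin (m + 1)) => w' q.1 q.2)
        (Ioi 0 ×ˢ closure Ω) ∧
      ∀ t ∈ Ioi (0 : ℝ), ∀ x ∈ closure Ω,
        HasDerivAt (fun s => w j s x) (w' t x) t)
    (hπt : ∃ π' : ℝ → EuclideanSpace ℝ (Fin (m + 1)) → Fin (n + 1) → ℝ,
      ContinuousOn (fun q : ℝ × EuclideanSpace ℝ (Fin (m + 1)) => π' q.1 q.2)
        (Ioi 0 ×ˢ closure Ω) ∧
      ∀ t ∈ Ioi (0 : ℝ), ∀ x ∈ closure Ω,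
        HasDerivAt (fun s => π s x) (π' t x) t)
    -- the adaptive aperiodically intermittent coupling strength
    (ψ : ℝ) (hψ : 0 < ψ)
    (Ψ : ℝ → ℝ) (hΨnn : ∀ t ≥ (0 : ℝ), 0 ≤ Ψ t) (hΨ0 : Ψ 0 = 0)
    (hΨrest : ∀ i, ∀ t ∈ Ioo (ss i) (ts (i + 1)), Ψ t = 0)
    (hΨjump : ∀ i, Ψ (ts (i + 1)) = Ψ (ss i))
    (hΨd : ∀ i, ∀ t ∈ Icc (ts i) (ss i),
      HasDerivWithinAt Ψ
        (ψ * sSup ((fun ς => ∑ j, ∫ x in Ω,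
          ∑ k, (w j (t + ς) x k - π (t + ς) x k) ^ 2) '' Icc (-τb) 0))
        (Icc (ts i) (ss i)) t)
    -- the target trajectory
    (hπeq : ∀ t > (0 : ℝ), ∀ x ∈ Ω,
      HasDerivAt (fun s => π s x) (drift D c A B η g h τ π t x) t)
    -- node `0` during the control spans (adaptively pinned)
    (hw0ctrl : ∀ i, ∀ t ∈ Icc (ts i) (ss i), 0 < t → ∀ x ∈ Ω,
      HasDerivAt (fun s => w 0 s x)
        (fun k => drift D c A B η g h τ (w 0) t x k
          - Ψ t * (∑ k', Ξ 0 k' * (γ2 k * lap (fun y => w k' t y k) x))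
          - Ψ t * σ * (γ2 k * lap (fun y => π t y k - w 0 t y k) x)) t)
    -- nodes `j ≠ 0` during the control spans (adaptive coupling)
    (hwctrl : ∀ j, j ≠ 0 → ∀ i, ∀ t ∈ Icc (ts i) (ss i), 0 < t → ∀ x ∈ Ω,
      HasDerivAt (fun s => w j s x)
        (fun k => drift D c A B η g h τ (w j) t x k
          - Ψ t * (∑ k', Ξ j k' * (γ2 k * lap (fun y => w k' t y k) x))) t)
    -- all nodes during the rest spans (coupling strength 1)
    (hwrest : ∀ j, ∀ i, ∀ t ∈ Ioo (ss i) (ts (i + 1)), ∀ x ∈ Ω,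
      HasDerivAt (fun s => w j s x)
        (fun k => drift D c A B η g h τ (w j) t x k
          - (∑ k', Ξ j k' * (γ2 k * lap (fun y => w k' t y k) x))) t) :
    Tendsto (fun t => Real.sqrt (∑ j, ∫ x in Ω, ∑ k, (w j t x k - π t x k) ^ 2))
      atTop (nhds 0) := by
  have ho := isOpen_box hΩ
  obtain ⟨p, hp, hpnull⟩ := exists_pos_vecMul_eq_zero Ξ hΞoff hΞrow hΞirr
  obtain ⟨c₀, hc₀, hform⟩ := exists_pinned_form_le Ξ hΞoff hΞrow hΞirr p hp hpnull 0
    (mul_pos hσ (hp 0))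
  obtain ⟨jm, hjm⟩ := Finite.exists_min p
  obtain ⟨km, hkm⟩ := Finite.exists_min γ2
  choose w' hw'c hw'd using hwt
  obtain ⟨π', hπ'c, hπ'd⟩ := hπt
  have hslice : ∀ {f : ℝ × EuclideanSpace ℝ (Fin (m + 1)) → ℝ} {s : Set ℝ} {t : ℝ}, t ∈ s →
      ContinuousOn f (s ×ˢ closure Ω) → ContinuousOn (fun x => f (t, x)) (closure Ω) :=
    fun ht hf => hf.comp (by fun_prop) fun x hx => ⟨ht, hx⟩
  have hπF : ∀ t ∈ Ici (-τb), ∀ k, DirichletField Ω (fun x => π t x k)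
      (par fun y => π t y k) (par2 fun y => π t y k) := fun t ht k =>
    .of_contDiffOn ho (contDiffOn_pi.1 (hπx t ht) k) (fun x hx => congrFun (hπbd t ht x hx) k)
      (fun r => hslice ht (hπx1 k r)) (fun r => hslice ht (hπx2 k r))
  have hwF : ∀ j, ∀ t ∈ Ici (-τb), ∀ k, DirichletField Ω (fun x => w j t x k)
      (par fun y => w j t y k) (par2 fun y => w j t y k) := fun j t ht k =>
    .of_contDiffOn ho (contDiffOn_pi.1 (hwx j t ht) k)
      (fun x hx => congrFun (hwbd j t ht x hx) k)
      (fun r => hslice ht (hwx1 j k r)) (fun r => hslice ht (hwx2 j k r))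
  have heC : ∀ j k, ContinuousOn (fun z : ℝ × EuclideanSpace ℝ (Fin (m + 1)) =>
      w j z.1 z.2 k - π z.1 z.2 k) (Ici (-τb) ×ˢ closure Ω) := fun j k =>
    (continuousOn_pi.1 (hwC j) k).sub (continuousOn_pi.1 hπC k)
  have he'C : ∀ j k, ContinuousOn (fun z : ℝ × EuclideanSpace ℝ (Fin (m + 1)) =>
      w' j z.1 z.2 k - π' z.1 z.2 k) (Ioi 0 ×ˢ closure Ω) := fun j k =>
    (continuousOn_pi.1 (hw'c j) k).sub (continuousOn_pi.1 hπ'c k)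
  have hIoi : Ioi (0 : ℝ) ⊆ Ici (-τb) := fun t ht => by
    simp only [mem_Ici, mem_Ioi] at *
    linarith
  set S : Fin (N + 1) → ℝ → ℝ := fun j t => ∫ x in Ω, ∑ k, (w j t x k - π t x k) ^ 2 with hS
  have hSn : ∀ j t, 0 ≤ S j t := fun j t =>
    integral_nonneg fun x => Finset.sum_nonneg fun k _ => sq_nonneg _
  have hSc : ∀ j, ContinuousOn (S j) (Ici (-τb)) := fun j =>
    continuousOn_integral_box hl hΩ
      (continuousOn_finsetSum _ fun k _ => (heC j k).pow 2)
  set S' : Fin (N + 1) → ℝ → ℝ := fun j t =>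
    ∫ x in Ω, ∑ k, 2 * ((w j t x k - π t x k) * (w' j t x k - π' t x k)) with hS'
  have hSd : ∀ j, ∀ t > 0, HasDerivAt (S j) (S' j t) t := fun j t ht => by
    refine hasDerivAt_integral_box hl hΩ (φ := fun t x => ∑ k, (w j t x k - π t x k) ^ 2)
      (φ' := fun t x => ∑ k, 2 * ((w j t x k - π t x k) * (w' j t x k - π' t x k)))
      ?_ (fun t ht => ?_) (fun t ht x hx => ?_) ht
    · exact continuousOn_finsetSum _ fun k _ => continuousOn_const.mul
        (((heC j k).mono (prod_mono_left hIoi)).mul (he'C j k))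
    · exact continuousOn_finsetSum _ fun k _ => (hslice (hIoi ht) (heC j k)).pow 2
    · refine HasDerivAt.fun_sum fun k _ => ?_
      have h1 := (hasDerivAt_pi.1 (hw'd j t ht x hx) k).fun_sub (hasDerivAt_pi.1 (hπ'd t ht x hx) k)
      refine (h1.fun_pow 2).congr_deriv ?_
      simp only [Nat.cast_ofNat, Nat.add_one_sub_one, pow_one]
      ring
  set V : ℝ → ℝ := fun t => ∑ j, p j * S j t with hV
  set V' : ℝ → ℝ := fun t => ∑ j, p j * S' j t with hV'
  have hVc : ContinuousOn V (Ici (-τb)) :=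
    continuousOn_finsetSum _ fun j _ => continuousOn_const.mul (hSc j)
  have hVn : ∀ t, 0 ≤ V t := fun t =>
    Finset.sum_nonneg fun j _ => mul_nonneg (hp j).le (hSn j t)
  have hVd : ∀ t > 0, HasDerivAt V (V' t) t := fun t ht =>
    HasDerivAt.fun_sum fun j _ => (hSd j t ht).const_mul (p j)
  set a₀ := (∑ k, ∑ q, |A k q|) / 2 * (1 + gs ^ 2) + (∑ k, ∑ q, |B k q|) / 2 with ha₀
  set b₀ := (∑ k, ∑ q, |B k q|) / 2 * hs ^ 2 with hb₀
  have hA0 : 0 ≤ ∑ k, ∑ q, |A k q| :=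
    Finset.sum_nonneg fun k _ => Finset.sum_nonneg fun q _ => abs_nonneg _
  have hB0 : 0 ≤ ∑ k, ∑ q, |B k q| :=
    Finset.sum_nonneg fun k _ => Finset.sum_nonneg fun q _ => abs_nonneg _
  have hrate : ∀ t > 0, ∀ q s a : ℝ, 0 ≤ a →
      (∀ y : Fin (N + 1) → ℝ,
        q * ∑ j, ∑ i, p j * Ξ j i * (y j * y i) - s * (p 0 * y 0 ^ 2) ≤ -a * ∑ j, y j ^ 2) →
      (∀ j, ∀ x ∈ Ω, HasDerivAt (fun s => w j s x)
        (fun k => drift D c A B η g h τ (w j) t x k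
          - q * (∑ k', Ξ j k' * (γ2 k * lap (fun y => w k' t y k) x))
          + (if j = 0 then s * (γ2 k * ∑ r, (par2 (fun y => w 0 t y k) r x
              - par2 (fun y => π t y k) r x)) else 0)) t) →
      V' t ≤ 2 * a₀ * V t + 2 * b₀ * V (t - τ t)
        - a * γ2 km / (2 * l 0 ^ 2) * ∑ j, S j t := by
    intro t ht q s a ha hQ hw
    have htm : t ∈ Ici (-τb) := hIoi ht
    have hτm : t - τ t ∈ Ici (-τb) := by
      simp only [mem_Ici]
      linarith [(hτ t).2]
    refine energy_rate_le hl hΩ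
      (u := fun j k x => w j t x k - π t x k)
      (v := fun j k x => w j (t - τ t) x k - π (t - τ t) x k)
      (ut := fun j k x => w' j t x k - π' t x k)
      (R := fun j k x => -(c k * (w j t x k - π t x k))
        + ∑ q, A k q * (g (w j t x) q - g (π t x) q)
        + ∑ q, B k q * (h (w j (t - τ t) x) q - h (π (t - τ t) x) q))
      (fun j k => (hwF j t htm k).sub (hπF t htm k)) (fun j k => hslice hτm (heC j k))
      (fun j k => hslice ht (he'C j k)) hD (hγ2 km).le hkm (fun j => (hp j).le) Ξ 0 ha hQ
      (fun x hx j k => ?_)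
      (fun x _ j => reaction_le hc A B hLipg hLiph _ _ _ _) 0
    have h1 := congrFun ((hw'd j t ht x (subset_closure hx)).unique (hw j x hx)) k
    have h2 := congrFun ((hπ'd t ht x (subset_closure hx)).unique (hπeq t ht x hx)) k
    have hrow : ∑ i, Ξ j i * (γ2 k * ∑ r, (par2 (fun y => w i t y k) r x
          - par2 (fun y => π t y k) r x))
        = ∑ i, Ξ j i * (γ2 k * ∑ r, par2 (fun y => w i t y k) r x) := by
      simp only [Finset.sum_sub_distrib, mul_sub]
      rw [← Finset.sum_mul, hΞrow, zero_mul, sub_zero]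
    rw [hrow, h1, h2]
    simp only [drift, lap, mul_sub, Finset.sum_sub_distrib]
    ring
  have hl0 : 0 < 2 * l 0 ^ 2 := by
    have := hl 0
    positivity
  have hp0 : 0 < ∑ j, p j := Finset.sum_pos (fun j _ => hp j) Finset.univ_nonempty
  have hVS : ∀ t, V t ≤ (∑ j, p j) * ∑ j, S j t := fun t => by
    rw [Finset.sum_mul]
    refine Finset.sum_le_sum fun j _ => mul_le_mul_of_nonneg_left ?_ (hp j).le
    exact Finset.single_le_sum (fun j _ => hSn j t) (Finset.mem_univ j)
  have hSV : ∀ t, ∑ j, S j t ≤ V t / p jm := fun t => by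
    rw [le_div_iff₀ (hp jm), Finset.sum_mul]
    refine Finset.sum_le_sum fun j _ => ?_
    rw [mul_comm]
    exact mul_le_mul_of_nonneg_right (hjm j) (hSn j t)
  set α := c₀ * γ2 km / (2 * l 0 ^ 2) / ∑ j, p j with hα
  have hα0 : 0 < α := by
    have := hγ2 km
    positivity
  have hctrl : ∀ i, ∀ t ∈ Icc (ts i) (ss i), 0 < t →
      V' t ≤ 2 * a₀ * V t - α * Ψ t * V t + 2 * b₀ * V (t - τ t) := by
    intro i t hti ht
    have hΨt := hΨnn t ht.le
    have h1 := hrate t ht (Ψ t) (Ψ t * σ) (Ψ t * c₀) (mul_nonneg hΨt hc₀.le)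
      (fun y => by
        have := mul_le_mul_of_nonneg_left (hform y) hΨt
        linarith)
      (fun j x hx => by
        by_cases hj : j = 0
        · subst hj
          refine (hw0ctrl i t hti ht x hx).congr_deriv (funext fun k => ?_)
          have hlap : lap (fun y => π t y k - w 0 t y k) x
              = ∑ r, (par2 (fun y => π t y k) r x - par2 (fun y => w 0 t y k) r x) :=
            Finset.sum_congr rfl fun r _ =>
              ((hπF t (hIoi ht) k).sub (hwF 0 t (hIoi ht) k)).par2_eq ho r hx
          rw [hlap, if_pos rfl]
          simp only [Finset.sum_sub_distrib]
          ring
        · refine (hwctrl j hj i t hti ht x hx).congr_deriv (funext fun k => ?_)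
          simp [hj])
    have h2 : α * Ψ t * V t ≤ Ψ t * c₀ * γ2 km / (2 * l 0 ^ 2) * ∑ j, S j t := by
      have h3 := mul_le_mul_of_nonneg_left (hVS t) (mul_nonneg hα0.le hΨt)
      have h4 : α * Ψ t * ((∑ j, p j) * ∑ j, S j t)
          = Ψ t * c₀ * γ2 km / (2 * l 0 ^ 2) * ∑ j, S j t := by
        rw [hα]
        field_simp
      linarith
    linarith
  have hgrow : ∀ t > 0, V' t ≤ 2 * a₀ * V t + 2 * b₀ * V (t - τ t) := by
    intro t ht
    obtain ⟨i, hi, hi'⟩ : ∃ i, ts i ≤ t ∧ t < ts (i + 1) := by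
      have hex : ∃ n, t < ts n := (htlim.eventually (eventually_gt_atTop t)).exists
      classical
      obtain ⟨k, hk⟩ : ∃ k, Nat.find hex = k + 1 := Nat.exists_eq_succ_of_ne_zero fun h0 => by
        have := Nat.find_spec hex
        rw [h0, hts0] at this
        linarith
      exact ⟨k, not_lt.1 (Nat.find_min hex (by omega)), hk ▸ Nat.find_spec hex⟩
    rcases le_or_gt t (ss i) with h | h
    · have h1 := hctrl i t ⟨hi, h⟩ ht
      have h2 := mul_nonneg (mul_nonneg hα0.le (hΨnn t ht.le)) (hVn t)
      linarith
    · have h1 := hrate t ht 1 0 0 le_rfl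
        (fun y => by
          have := sum_sum_mul_nonpos Ξ hΞoff hΞrow p hp hpnull y
          linarith)
        (fun j x hx => by
          refine (hwrest j i t ⟨h, hi'⟩ x hx).congr_deriv (funext fun k => ?_)
          simp)
      rw [zero_mul, zero_div, zero_mul, sub_zero] at h1
      linarith
  have hwidth : ∀ i, θ ≤ ss i - ts i := fun i => by
    rw [← hinf]
    exact ciInf_le ⟨0, by rintro _ ⟨i, rfl⟩; exact (sub_pos.2 (hcs i)).le⟩ i
  have hperiod : ∀ i, ts (i + 1) - ts i ≤ ω := fun i => by
    have hbdd : BddAbove (range fun i => ts (i + 1) - ts i) := by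
      by_contra hcon
      rw [Real.iSup_of_not_bddAbove hcon] at hsup
      linarith
    rw [← hsup]
    exact le_ciSup hbdd i
  have hVlim : Tendsto V atTop (nhds 0) := by
    refine tendsto_zero_of_adaptive_intermittent (κ := ψ / ∑ j, p j) hτ (by positivity)
      (by positivity) hα0 (by positivity) hθ hτθ hVc (fun t _ => hVn t) hVd hgrow hts0 hrs htlim
      hwidth hperiod hctrl hΨjump hΨd (fun t ht s hs => ?_)
    have hbdd : BddAbove ((fun ς => ∑ j, S j (t + ς)) '' Icc (-τb) 0) := by
      refine isCompact_Icc.bddAbove_image (continuousOn_finsetSum _ fun j _ => ?_)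
      refine (hSc j).comp (by fun_prop) fun ς hς => ?_
      simp only [mem_Ici]
      linarith [hς.1]
    have hle : ∑ j, S j s ≤ sSup ((fun ς => ∑ j, S j (t + ς)) '' Icc (-τb) 0) := by
      refine le_csSup hbdd ⟨s - t, ⟨by linarith [hs.1], by linarith [hs.2]⟩, ?_⟩
      simp
    have h1 : V s / ∑ j, p j ≤ ∑ j, S j s := by
      rw [div_le_iff₀ hp0, mul_comm]
      exact hVS s
    calc ψ / (∑ j, p j) * V s = ψ * (V s / ∑ j, p j) := by ring
      _ ≤ _ := mul_le_mul_of_nonneg_left (h1.trans hle) hψ.le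
  have hSlim : Tendsto (fun t => ∑ j, S j t) atTop (nhds 0) :=
    squeeze_zero (fun t => Finset.sum_nonneg fun j _ => hSn j t) hSV
      (by simpa using hVlim.div_const (p jm))
  simpa using hSlim.sqrt
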